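/- For any seven points p₁,…,p₇ in EuclideanSpace ℝ (Fin 3) each of norm 1 (i.e., lying on the unit sphere), the volume of their convex hull satisfies vol(convexHull ℝ {p₁,…,p₇}) ≤ (5/3)·sin(2π/5). (Berman–Hanes: the maximal volume polyhedron with 7 vertices inscribed in the unit sphere is the pentagonal bipyramid, of volume (5/3)·sin(2π/5).) -/

import Mathlib

open MeasureTheory Real

/-- combinatorial classification -/
theorem bh_classify (R : Fin 7 → Fin 7 → Fin 7 → Prop) (deg : Fin 7 → ℕ) (nb : Fin 7 → Finset (Fin 7))
    (hdeg : ∀ v, deg v = (nb v).card)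
    (hnb : ∀ v a, a ∈ nb v ↔ ∃ b, R v a b)
    (hrot : ∀ i j k, R i j k → R j k i)
    (hun : ∀ i j k l, R i j k → R i j l → k = l)
    (hopp : ∀ i j k, R i j k → ∃ l, R j i l)
    (hne : ∀ i j k, R i j k → i ≠ j ∧ j ≠ k ∧ i ≠ k)
    (hno : ∀ i j k, R i j k → ¬ R j i k)
    (hused : ∀ v, (nb v).Nonempty)
    (hsum : ∑ v, deg v = 30)
    (h3 : ∀ v a b c, R v a b → R v b c → ¬ R v c a) :
    ∃ x x' : Fin 7, x ≠ x' ∧ x' ∉ nb x ∧ deg x = 5 ∧ deg x' = 5 ∧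
      (∃ a b c d e, R x a b ∧ R x b c ∧ R x c d ∧ R x d e ∧ R x e a ∧ nb x = {a, b, c, d, e} ∧ [a, b, c, d, e].Nodup) ∧
      (∃ a b c d e, R x' a b ∧ R x' b c ∧ R x' c d ∧ R x' d e ∧ R x' e a ∧ nb x' = {a, b, c, d, e} ∧ [a, b, c, d, e].Nodup) := by
  -- basic facts
  have hmem1 : ∀ v a b, R v a b → a ∈ nb v := fun v a b h => (hnb v a).2 ⟨b, h⟩
  have hmem2 : ∀ v a b, R v a b → b ∈ nb v := by
    intro v a b h
    obtain ⟨l, hl⟩ := hopp _ _ _ (hrot _ _ _ (hrot _ _ _ h))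
    exact hmem1 _ _ _ hl
  have hinj : ∀ v a b c, R v a c → R v b c → a = b := by
    intro v a b c h1 h2
    exact hun c v a b (hrot _ _ _ (hrot _ _ _ h1)) (hrot _ _ _ (hrot _ _ _ h2))
  have hno' : ∀ v a b, R v a b → ¬ R v b a := by
    intro v a b h1 h2
    exact hno a b v (hrot _ _ _ h1) (hrot _ _ _ h2)
  have hnext : ∀ v a, a ∈ nb v → ∃ b, R v a b := fun v a h => (hnb v a).1 h
  have hself : ∀ v, v ∉ nb v := by
    intro v h
    obtain ⟨b, hb⟩ := hnext _ _ h
    exact (hne _ _ _ hb).1 rfl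
  have hsymm : ∀ v a, a ∈ nb v → v ∈ nb a := by
    intro v a h
    obtain ⟨b, hb⟩ := hnext _ _ h
    obtain ⟨l, hl⟩ := hopp _ _ _ hb
    exact hmem1 _ _ _ hl
  -- four chain
  have hchain : ∀ v a, a ∈ nb v → ∃ b c d, R v a b ∧ R v b c ∧ R v c d ∧ a ≠ b ∧ a ≠ c ∧ a ≠ d ∧
      b ≠ c ∧ b ≠ d ∧ c ≠ d := by
    intro v a ha
    obtain ⟨b, hb⟩ := hnext _ _ ha
    obtain ⟨c, hc⟩ := hnext _ _ (hmem2 _ _ _ hb)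
    obtain ⟨d, hd⟩ := hnext _ _ (hmem2 _ _ _ hc)
    refine ⟨b, c, d, hb, hc, hd, (hne _ _ _ hb).2.1, ?_, ?_, (hne _ _ _ hc).2.1, ?_, (hne _ _ _ hd).2.1⟩
    · rintro rfl; exact hno' _ _ _ hb hc
    · rintro rfl; exact h3 _ _ _ _ hb hc hd
    · rintro rfl; exact hno' _ _ _ hc hd
  have hdeg4 : ∀ v, 4 ≤ deg v := by
    intro v
    obtain ⟨a, ha⟩ := hused v
    obtain ⟨b, c, d, hb, hc, hd, n1, n2, n3, n4, n5, n6⟩ := hchain v a ha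
    rw [hdeg]
    have : ({a, b, c, d} : Finset (Fin 7)) ⊆ nb v := by
      intro t ht
      simp only [Finset.mem_insert, Finset.mem_singleton] at ht
      rcases ht with rfl | rfl | rfl | rfl
      · exact ha
      · exact hmem1 _ _ _ hc
      · exact hmem1 _ _ _ hd
      · exact hmem2 _ _ _ hd
    calc 4 = ({a, b, c, d} : Finset (Fin 7)).card := by
          rw [Finset.card_insert_of_notMem, Finset.card_insert_of_notMem, Finset.card_pair] <;> simp [*]
      _ ≤ _ := Finset.card_le_card this
  -- degree 4 links
  have hlink4 : ∀ v a b c, deg v = 4 → R v a b → R v b c → ∃ d, R v c d ∧ R v d a := by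
    intro v a b c h4 hab hbc
    obtain ⟨b', c', d, hb, hc, hd, n1, n2, n3, n4, n5, n6⟩ := hchain v a (hmem1 _ _ _ hab)
    obtain rfl := hun _ _ _ _ hab hb
    obtain rfl := hun _ _ _ _ hbc hc
    refine ⟨d, hd, ?_⟩
    have hs : ({a, b, c, d} : Finset (Fin 7)) ⊆ nb v := by
      intro t ht
      simp only [Finset.mem_insert, Finset.mem_singleton] at ht
      rcases ht with rfl | rfl | rfl | rfl
      · exact hmem1 _ _ _ hab
      · exact hmem1 _ _ _ hc
      · exact hmem1 _ _ _ hd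
      · exact hmem2 _ _ _ hd
    have hc4 : ({a, b, c, d} : Finset (Fin 7)).card = 4 := by
      rw [Finset.card_insert_of_notMem, Finset.card_insert_of_notMem, Finset.card_pair] <;> simp [*]
    have heq := Finset.eq_of_subset_of_card_le hs (by rw [hc4, ← hdeg, h4])
    obtain ⟨e, he⟩ := hnext _ _ (hmem2 _ _ _ hd)
    have hem := hmem2 _ _ _ he
    rw [← heq] at hem
    simp only [Finset.mem_insert, Finset.mem_singleton] at hem
    rcases hem with rfl | rfl | rfl | rfl
    · exact he
    · exact absurd (hinj _ _ _ _ hab he) n3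
    · exact absurd (hinj _ _ _ _ hbc he) n5
    · exact absurd rfl (hne _ _ _ he).2.1
  -- degree 5 links
  have hlink5 : ∀ v a, deg v = 5 → a ∈ nb v → ∃ b c d e, R v a b ∧ R v b c ∧ R v c d ∧ R v d e ∧
      R v e a ∧ nb v = {a, b, c, d, e} ∧ a ≠ b ∧ a ≠ c ∧ a ≠ d ∧
      b ≠ c ∧ b ≠ d ∧ c ≠ d ∧ a ≠ e ∧ b ≠ e ∧ c ≠ e ∧ d ≠ e := by
    intro v a h5 ha
    obtain ⟨b, c, d, hb, hc, hd, n1, n2, n3, n4, n5, n6⟩ := hchain v a ha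
    obtain ⟨e, he⟩ := hnext _ _ (hmem2 _ _ _ hd)
    have m1 : b ≠ e := by rintro rfl; exact n3 (hinj _ _ _ _ hb he)
    have m2 : c ≠ e := by rintro rfl; exact n5 (hinj _ _ _ _ hc he)
    have m3 : d ≠ e := (hne _ _ _ he).2.1
    have hc4 : ({a, b, c, d} : Finset (Fin 7)).card = 4 := by
      rw [Finset.card_insert_of_notMem, Finset.card_insert_of_notMem, Finset.card_pair] <;> simp [*]
    have hs4 : ({a, b, c, d} : Finset (Fin 7)) ⊆ nb v := by
      intro t ht
      simp only [Finset.mem_insert, Finset.mem_singleton] at ht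
      rcases ht with rfl | rfl | rfl | rfl
      · exact ha
      · exact hmem1 _ _ _ hc
      · exact hmem1 _ _ _ hd
      · exact hmem2 _ _ _ hd
    have m0 : a ≠ e := by
      rintro rfl
      obtain ⟨f, hf, hf'⟩ : ∃ f ∈ nb v, f ∉ ({a, b, c, d} : Finset (Fin 7)) := by
        by_contra hcon
        push Not at hcon
        have := Finset.card_le_card (show nb v ⊆ _ from hcon)
        rw [hc4, ← hdeg] at this
        omega
      have hs5 : insert f ({a, b, c, d} : Finset (Fin 7)) ⊆ nb v := Finset.insert_subset hf hs4
      have heq := Finset.eq_of_subset_of_card_le hs5 (by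
        rw [Finset.card_insert_of_notMem hf', hc4, ← hdeg, h5])
      obtain ⟨g, hg⟩ := hnext _ _ hf
      have hgm := hmem2 _ _ _ hg
      rw [← heq] at hgm
      simp only [Finset.mem_insert, Finset.mem_singleton] at hgm
      simp only [Finset.mem_insert, Finset.mem_singleton, not_or] at hf'
      rcases hgm with rfl | rfl | rfl | rfl | rfl
      · exact (hne _ _ _ hg).2.1 rfl
      · exact hf'.2.2.2 (hinj _ _ _ _ hg he)
      · exact hf'.1 (hinj _ _ _ _ hg hb)
      · exact hf'.2.1 (hinj _ _ _ _ hg hc)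
      · exact hf'.2.2.1 (hinj _ _ _ _ hg hd)
    have hs : ({a, b, c, d, e} : Finset (Fin 7)) ⊆ nb v := by
      intro t ht
      simp only [Finset.mem_insert, Finset.mem_singleton] at ht
      rcases ht with rfl | rfl | rfl | rfl | rfl
      · exact ha
      · exact hmem1 _ _ _ hc
      · exact hmem1 _ _ _ hd
      · exact hmem2 _ _ _ hd
      · exact hmem2 _ _ _ he
    have hc5 : ({a, b, c, d, e} : Finset (Fin 7)).card = 5 := by
      rw [Finset.card_insert_of_notMem, Finset.card_insert_of_notMem, Finset.card_insert_of_notMem,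
        Finset.card_pair] <;> simp [*]
    have heq := Finset.eq_of_subset_of_card_le hs (by rw [hc5, ← hdeg, h5])
    refine ⟨b, c, d, e, hb, hc, hd, he, ?_, heq.symm, n1, n2, n3, n4, n5, n6, m0, m1, m2, m3⟩
    obtain ⟨f, hf⟩ := hnext _ _ (hmem2 _ _ _ he)
    have hfm := hmem2 _ _ _ hf
    rw [← heq] at hfm
    simp only [Finset.mem_insert, Finset.mem_singleton] at hfm
    rcases hfm with rfl | rfl | rfl | rfl | rfl
    · exact hf
    · exact absurd (hinj _ _ _ _ hb hf) m0
    · exact absurd (hinj _ _ _ _ hc hf) m1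
    · exact absurd (hinj _ _ _ _ hd hf) m2
    · exact absurd rfl (hne _ _ _ hf).2.1
  -- propagation
  have hprop : ∀ x a b d y, deg b = 4 → R x a b → R x b d → R b a y → R d b y := by
    intro x a b d y h4 hab hbd hy
    obtain ⟨y', h1, h2⟩ := hlink4 b d x a h4 (hrot _ _ _ hbd) (hrot _ _ _ (hrot _ _ _ hab))
    obtain rfl := hun _ _ _ _ hy h1
    exact hrot _ _ _ (hrot _ _ _ h2)
  have hle6 : ∀ v, deg v ≤ 6 := by
    intro v
    rw [hdeg]
    have : nb v ⊆ Finset.univ.erase v := by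
      intro t ht
      simp only [Finset.mem_erase, Finset.mem_univ, and_true]
      rintro rfl
      exact hself _ ht
    simpa using Finset.card_le_card this
  -- no degree 6
  have hno6 : ∀ x, deg x ≠ 6 := by
    intro x h6
    have hoth : ∀ v, v ≠ x → deg v = 4 := by
      by_contra hcon
      push Not at hcon
      obtain ⟨v, hv, hv4⟩ := hcon
      have hv5 : 5 ≤ deg v := by have := hdeg4 v; omega
      have e1 := Finset.add_sum_erase Finset.univ deg (Finset.mem_univ x)
      have e2 := Finset.add_sum_erase (Finset.univ.erase x) deg (show v ∈ _ by simp [hv])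
      have e3 := Finset.card_nsmul_le_sum ((Finset.univ.erase x).erase v) (fun t => deg t) 4 (fun t _ => hdeg4 t)
      rw [Finset.card_erase_of_mem (by simp [hv]), Finset.card_erase_of_mem (by simp)] at e3
      simp only [Finset.card_univ, Fintype.card_fin, smul_eq_mul] at e3
      omega
    have hadj : ∀ v, v ≠ x → v ∈ nb x := by
      have hsub : nb x ⊆ Finset.univ.erase x := by
        intro t ht
        simp only [Finset.mem_erase, Finset.mem_univ, and_true]
        rintro rfl
        exact hself _ ht
      have := Finset.eq_of_subset_of_card_le hsub (by rw [← hdeg, h6]; simp)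
      intro v hv
      rw [this]; simp [hv]
    obtain ⟨a, ha⟩ := hused x
    obtain ⟨b, d, e, hb, hd, he, n1, n2, n3, n4, n5, n6⟩ := hchain x a ha
    obtain ⟨y, hy⟩ := hopp _ _ _ (hrot _ _ _ hb)
    have ax := (hne _ _ _ hb).1
    have bx := (hne _ _ _ hd).1
    have dx := (hne _ _ _ he).1
    have ex := (hne _ _ _ he).2.2
    have hy2 := hprop _ _ _ _ _ (hoth b bx.symm) hb hd hy
    have hy3 := hprop _ _ _ _ _ (hoth d dx.symm) hd he hy2
    have yx : y ≠ x := by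
      rintro rfl
      exact hno _ _ _ (hrot _ _ _ hb) hy
    have hxy := hsymm _ _ (hadj y yx)
    have hs : ({x, a, b, d, e} : Finset (Fin 7)) ⊆ nb y := by
      intro t ht
      simp only [Finset.mem_insert, Finset.mem_singleton] at ht
      rcases ht with rfl | rfl | rfl | rfl | rfl
      · exact hxy
      · exact hmem2 _ _ _ (hrot _ _ _ (hrot _ _ _ hy))
      · exact hmem1 _ _ _ (hrot _ _ _ (hrot _ _ _ hy))
      · exact hmem1 _ _ _ (hrot _ _ _ (hrot _ _ _ hy2))
      · exact hmem1 _ _ _ (hrot _ _ _ (hrot _ _ _ hy3))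
    have hc5 : ({x, a, b, d, e} : Finset (Fin 7)).card = 5 := by
      rw [Finset.card_insert_of_notMem, Finset.card_insert_of_notMem, Finset.card_insert_of_notMem,
        Finset.card_pair] <;> simp [*]
    have := Finset.card_le_card hs
    rw [hc5, ← hdeg, hoth y yx] at this
    omega
  obtain ⟨x, hx⟩ : ∃ x, deg x = 5 := by
    by_contra hcon
    push Not at hcon
    have : ∀ v, deg v = 4 := fun v => by
      have := hdeg4 v; have := hle6 v; have := hno6 v; have := hcon v; omega
    simp [this] at hsum
  obtain ⟨x', hxx, hx'⟩ : ∃ x', x' ≠ x ∧ deg x' = 5 := by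
    by_contra hcon
    push Not at hcon
    have h4 : ∀ v ∈ Finset.univ.erase x, deg v = 4 := fun v hv => by
      have := hdeg4 v; have := hle6 v; have := hno6 v; have := hcon v (Finset.ne_of_mem_erase hv); omega
    have e1 := Finset.add_sum_erase Finset.univ deg (Finset.mem_univ x)
    rw [Finset.sum_congr rfl h4] at e1
    simp at e1
    omega
  have hoth : ∀ v, v ≠ x → v ≠ x' → deg v = 4 := by
    by_contra hcon
    push Not at hcon
    obtain ⟨v, hv, hvx', hv4⟩ := hcon
    have hv5 : 5 ≤ deg v := by have := hdeg4 v; omega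
    have e1 := Finset.add_sum_erase Finset.univ deg (Finset.mem_univ x)
    have e2 := Finset.add_sum_erase (Finset.univ.erase x) deg (show v ∈ _ by simp [hv])
    have e4 := Finset.add_sum_erase ((Finset.univ.erase x).erase v) deg
      (show x' ∈ _ by simp [hxx, hvx'.symm])
    have e3 := Finset.card_nsmul_le_sum (((Finset.univ.erase x).erase v).erase x') (fun t => deg t) 4
      (fun t _ => hdeg4 t)
    rw [Finset.card_erase_of_mem (by simp [hxx, hvx'.symm]), Finset.card_erase_of_mem (by simp [hv]),
      Finset.card_erase_of_mem (by simp)] at e3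
    simp only [Finset.card_univ, Fintype.card_fin, smul_eq_mul] at e3
    omega
  refine ⟨x, x', hxx.symm, ?_, hx, hx', ?_, ?_⟩
  · intro hadj
    obtain ⟨a, b, c, d, ha, hb, hc, hd, hd', hnbx, n1, n2, n3, n4, n5, n6, n7, n8, n9, n10⟩ :=
      hlink5 x x' hx hadj
    obtain ⟨y, hy⟩ := hopp _ _ _ (hrot _ _ _ ha)
    have ax := (hne _ _ _ hb).1
    have bx := (hne _ _ _ hc).1
    have cx := (hne _ _ _ hd).1
    have dx := (hne _ _ _ hd').1
    have hy2 := hprop _ _ _ _ _ (hoth a ax.symm n1.symm) ha hb hy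
    have hy3 := hprop _ _ _ _ _ (hoth b bx.symm n2.symm) hb hc hy2
    have hy4 := hprop _ _ _ _ _ (hoth c cx.symm n3.symm) hc hd hy3
    have yx : y ≠ x := by
      rintro rfl
      exact hno _ _ _ (hrot _ _ _ ha) hy
    have yx' : y ≠ x' := (hne _ _ _ hy).2.1.symm
    have hs : ({x', a, b, c, d} : Finset (Fin 7)) ⊆ nb y := by
      intro t ht
      simp only [Finset.mem_insert, Finset.mem_singleton] at ht
      rcases ht with rfl | rfl | rfl | rfl | rfl
      · exact hmem2 _ _ _ (hrot _ _ _ (hrot _ _ _ hy))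
      · exact hmem1 _ _ _ (hrot _ _ _ (hrot _ _ _ hy))
      · exact hmem1 _ _ _ (hrot _ _ _ (hrot _ _ _ hy2))
      · exact hmem1 _ _ _ (hrot _ _ _ (hrot _ _ _ hy3))
      · exact hmem1 _ _ _ (hrot _ _ _ (hrot _ _ _ hy4))
    have := Finset.card_le_card hs
    rw [← hnbx, ← hdeg, hx, ← hdeg, hoth y yx yx'] at this
    omega
  · obtain ⟨a, ha⟩ := hused x
    obtain ⟨b, c, d, e, h⟩ := hlink5 x a hx ha
    exact ⟨a, b, c, d, e, h.1, h.2.1, h.2.2.1, h.2.2.2.1, h.2.2.2.2.1, h.2.2.2.2.2.1, by simp [h]⟩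
  · obtain ⟨a, ha⟩ := hused x'
    obtain ⟨b, c, d, e, h⟩ := hlink5 x' a hx' ha
    exact ⟨a, b, c, d, e, h.1, h.2.1, h.2.2.1, h.2.2.2.1, h.2.2.2.2.1, h.2.2.2.2.2.1, by simp [h]⟩

abbrev bhE := EuclideanSpace ℝ (Fin 3)

/-- the determinant of three vectors -/
noncomputable def bhD (a b c : bhE) : ℝ :=
  a 0 * (b 1 * c 2 - b 2 * c 1) - a 1 * (b 0 * c 2 - b 2 * c 0) + a 2 * (b 0 * c 1 - b 1 * c 0)

theorem bh_normsq (a : bhE) (h : ‖a‖ ≤ 1) : a 0 ^ 2 + a 1 ^ 2 + a 2 ^ 2 ≤ 1 := by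
  have h1 : ‖a‖ ^ 2 ≤ 1 := by nlinarith [norm_nonneg a]
  rw [EuclideanSpace.norm_sq_eq, Fin.sum_univ_three] at h1
  simpa using h1

theorem bhD_rot (a b c : bhE) : bhD b c a = bhD a b c := by unfold bhD; ring

/-- Cauchy-Schwarz form for the determinant -/
theorem bhD_sq_le (a b c : bhE) (hc : ‖c‖ ≤ 1) :
    bhD a b c ^ 2 ≤ (a 1 * b 2 - a 2 * b 1) ^ 2 + (a 2 * b 0 - a 0 * b 2) ^ 2
      + (a 0 * b 1 - a 1 * b 0) ^ 2 := by
  have h := bh_normsq c hc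
  set x := a 1 * b 2 - a 2 * b 1
  set y := a 2 * b 0 - a 0 * b 2
  set z := a 0 * b 1 - a 1 * b 0
  have e : bhD a b c = x * c 0 + y * c 1 + z * c 2 := by simp only [x, y, z]; unfold bhD; ring
  rw [e]
  nlinarith [sq_nonneg (x * c 1 - y * c 0), sq_nonneg (x * c 2 - z * c 0), sq_nonneg (y * c 2 - z * c 1),
    mul_nonneg (sub_nonneg.2 h) (add_nonneg (add_nonneg (sq_nonneg x) (sq_nonneg y)) (sq_nonneg z))]

theorem bhD_le_one (a b c : bhE) (ha : ‖a‖ ≤ 1) (hb : ‖b‖ ≤ 1) (hc : ‖c‖ ≤ 1) : bhD a b c ≤ 1 := by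
  have h := bhD_sq_le a b c hc
  have h1 := bh_normsq a ha
  have h2 := bh_normsq b hb
  have h3 : (a 0 ^ 2 + a 1 ^ 2 + a 2 ^ 2) * (b 0 ^ 2 + b 1 ^ 2 + b 2 ^ 2) ≤ 1 := by
    apply mul_le_one₀ h1 (by positivity) h2
  have : bhD a b c ^ 2 ≤ 1 := by nlinarith [sq_nonneg (a 0 * b 0 + a 1 * b 1 + a 2 * b 2)]
  nlinarith

theorem bh_sin_sq : sin (2 * π / 5) ^ 2 = (5 + √5) / 8 := by
  have h : cos (2 * π / 5) = (√5 - 1) / 4 := by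
    have : 2 * π / 5 = 2 * (π / 5) := by ring
    rw [this, cos_two_mul, cos_pi_div_five]
    have h5 : √5 ^ 2 = 5 := Real.sq_sqrt (by norm_num)
    linear_combination (1/8) * h5
  have h5 : √5 ^ 2 = 5 := Real.sq_sqrt (by norm_num)
  have := sin_sq_add_cos_sq (2 * π / 5)
  rw [h] at this
  linear_combination this - (1/16) * h5

theorem bh_sin_pos : 0 < sin (2 * π / 5) :=
  sin_pos_of_pos_of_lt_pi (by positivity) (by linarith [pi_pos])

theorem bh_sin_lb : (0.95 : ℝ) ≤ sin (2 * π / 5) := by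
  have h := bh_sin_sq
  have h5 : (2.236 : ℝ) ≤ √5 := Real.le_sqrt_of_sq_le (by norm_num)
  nlinarith [bh_sin_pos]

/-- the circulant inequality -/
theorem bh_circ (x y z u w : ℝ) :
    (y - w) ^ 2 + (z - x) ^ 2 + (u - y) ^ 2 + (w - z) ^ 2 + (x - u) ^ 2
      ≤ (5 + √5) / 2 * (x ^ 2 + y ^ 2 + z ^ 2 + u ^ 2 + w ^ 2) := by
  have h5 : √5 ^ 2 = 5 := Real.sq_sqrt (by norm_num)
  have hs : (2.236 : ℝ) ≤ √5 := Real.le_sqrt_of_sq_le (by norm_num)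
  set s := √5
  have key : (5 + s) / 2 * (x ^ 2 + y ^ 2 + z ^ 2 + u ^ 2 + w ^ 2) -
    ((y - w) ^ 2 + (z - x) ^ 2 + (u - y) ^ 2 + (w - z) ^ 2 + (x - u) ^ 2) =
    (1 + s) / 5 * ((x + (s - 1) / 2 * (z + u)) ^ 2 + (y + (s - 1) / 2 * (u + w)) ^ 2 +
      (z + (s - 1) / 2 * (w + x)) ^ 2 + (u + (s - 1) / 2 * (x + y)) ^ 2 + (w + (s - 1) / 2 * (y + z)) ^ 2)
    + 1 / 5 * ((y + w - (s - 1) / 2 * x) ^ 2 + (z + x - (s - 1) / 2 * y) ^ 2 +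
      (u + y - (s - 1) / 2 * z) ^ 2 + (w + z - (s - 1) / 2 * u) ^ 2 + (x + u - (s - 1) / 2 * w) ^ 2) := by
    linear_combination -(2 / 5 * (x * z + y * u + z * w + u * x + w * y) +
      (s - 1) / 10 * (x * y + y * z + z * u + u * w + w * x) +
      (1 / 20 + (s - 1) / 10) * (x ^ 2 + y ^ 2 + z ^ 2 + u ^ 2 + w ^ 2)) * h5
  have : 0 ≤ (5 + s) / 2 * (x ^ 2 + y ^ 2 + z ^ 2 + u ^ 2 + w ^ 2) -
    ((y - w) ^ 2 + (z - x) ^ 2 + (u - y) ^ 2 + (w - z) ^ 2 + (x - u) ^ 2) := by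
    rw [key]; positivity
  linarith

theorem bh_cross_le (v e d : bhE) (hv : ‖v‖ ≤ 1) (l : ℝ) (hl : 0 < l) :
    2 * l * bhD v e d ≤ l ^ 2 * (e 0 ^ 2 + e 1 ^ 2 + e 2 ^ 2) + (d 0 ^ 2 + d 1 ^ 2 + d 2 ^ 2) := by
  have h := bhD_sq_le e d v hv
  rw [bhD_rot] at h
  set X := bhD v e d
  set A := e 0 ^ 2 + e 1 ^ 2 + e 2 ^ 2 with hA
  set B := d 0 ^ 2 + d 1 ^ 2 + d 2 ^ 2 with hB
  have hA0 : 0 ≤ A := by positivity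
  have hB0 : 0 ≤ B := by positivity
  have h2 : X ^ 2 ≤ A * B := by
    rw [hA, hB]; nlinarith [sq_nonneg (e 0 * d 0 + e 1 * d 1 + e 2 * d 2)]
  apply le_of_sq_le_sq _ (by positivity)
  nlinarith [sq_nonneg (l ^ 2 * A - B), mul_nonneg (sq_nonneg l) (sub_nonneg.2 h2)]

theorem bh_star5 (v a b c d e : bhE) (hv : ‖v‖ ≤ 1) (ha : ‖a‖ ≤ 1) (hb : ‖b‖ ≤ 1) (hc : ‖c‖ ≤ 1)
    (hd : ‖d‖ ≤ 1) (he : ‖e‖ ≤ 1) :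
    bhD v a b + bhD v b c + bhD v c d + bhD v d e + bhD v e a ≤ 5 * sin (2 * π / 5) := by
  set s := sin (2 * π / 5) with hs
  have hs0 : 0 < s := bh_sin_pos
  have hs2 : (5 + √5) / 2 = 4 * s ^ 2 := by rw [hs, bh_sin_sq]; ring
  have c0 := bh_circ (a 0) (b 0) (c 0) (d 0) (e 0)
  have c1 := bh_circ (a 1) (b 1) (c 1) (d 1) (e 1)
  have c2 := bh_circ (a 2) (b 2) (c 2) (d 2) (e 2)
  rw [hs2] at c0 c1 c2
  have l1 := bh_cross_le v a (b - e) hv (2 * s) (by positivity)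
  have l2 := bh_cross_le v b (c - a) hv (2 * s) (by positivity)
  have l3 := bh_cross_le v c (d - b) hv (2 * s) (by positivity)
  have l4 := bh_cross_le v d (e - c) hv (2 * s) (by positivity)
  have l5 := bh_cross_le v e (a - d) hv (2 * s) (by positivity)
  have hsum : bhD v a (b - e) + bhD v b (c - a) + bhD v c (d - b) + bhD v d (e - c) + bhD v e (a - d)
    = 2 * (bhD v a b + bhD v b c + bhD v c d + bhD v d e + bhD v e a) := by
    unfold bhD; simp only [PiLp.sub_apply]; ring
  simp only [PiLp.sub_apply] at l1 l2 l3 l4 l5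
  set S := bhD v a b + bhD v b c + bhD v c d + bhD v d e + bhD v e a
  have na := bh_normsq a ha
  have nb := bh_normsq b hb
  have nc := bh_normsq c hc
  have nd := bh_normsq d hd
  have ne := bh_normsq e he
  have h1 : 2 * (2 * s) * (2 * S) ≤ 4 * s ^ 2 * 5 + 4 * s ^ 2 * 5 := by
    rw [← hsum]
    have m := mul_le_mul_of_nonneg_left
      (add_le_add (add_le_add (add_le_add (add_le_add na nb) nc) nd) ne) (sq_nonneg s)
    clear_value S s
    linarith
  have h2 : s * S ≤ s * (5 * s) := by
    clear_value S s
    clear * - h1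
    linarith
  exact le_of_mul_le_mul_left h2 hs0

theorem bh_tri_aux (N X Y Z P Q R : ℝ)
    (k0 : 4 * N ^ 2 ≤ 2 * (P * Q + Q * R + R * P) - (P ^ 2 + Q ^ 2 + R ^ 2))
    (k1 : 4 * X ^ 2 ≤ 4 * P - P ^ 2) (k2 : 4 * Y ^ 2 ≤ 4 * Q - Q ^ 2) (k3 : 4 * Z ^ 2 ≤ 4 * R - R ^ 2) :
    N + X + Y + Z ≤ 3 * √3 := by
  have hQ45 : N ^ 2 / 3 + (X ^ 2 + Y ^ 2 + Z ^ 2) ≤ 9 / 2 := by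
    nlinarith [sq_nonneg (P + Q + R - 9), sq_nonneg (P - Q), sq_nonneg (Q - R), sq_nonneg (R - P)]
  have h3 : √3 ^ 2 = 3 := Real.sq_sqrt (by norm_num)
  have h3p : 0 < √3 := by positivity
  set t := √3
  have : t * (N + X + Y + Z) ≤ t * (3 * t) := by
    nlinarith [sq_nonneg (N - 3 * t / 2), sq_nonneg (X - t / 2), sq_nonneg (Y - t / 2), sq_nonneg (Z - t / 2)]
  exact le_of_mul_le_mul_left this h3p

theorem bh_tri_aux2 (A B P X : ℝ) (hA : A ≤ 1) (hB : B ≤ 1) (hP : 0 ≤ P)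
    (h : 4 * X ^ 2 ≤ -(A - B) ^ 2 + 2 * (A + B) * P - P ^ 2) : 4 * X ^ 2 ≤ 4 * P - P ^ 2 := by
  nlinarith [mul_nonneg (sub_nonneg.2 (add_le_add hA hB)) hP, sq_nonneg (A - B)]

theorem bh_tri (v a b c r1 r2 r3 : bhE) (hv : ‖v‖ ≤ 1) (ha : ‖a‖ ≤ 1) (hb : ‖b‖ ≤ 1) (hc : ‖c‖ ≤ 1)
    (h1 : ‖r1‖ ≤ 1) (h2 : ‖r2‖ ≤ 1) (h3 : ‖r3‖ ≤ 1) :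
    bhD v a b + bhD v b c + bhD v c a + bhD b a r1 + bhD c b r2 + bhD a c r3 ≤ 3 * √3 := by
  have na := bh_normsq a ha
  have nb := bh_normsq b hb
  have nc := bh_normsq c hc
  have q1 := bhD_sq_le b a r1 h1
  have q2 := bhD_sq_le c b r2 h2
  have q3 := bhD_sq_le a c r3 h3
  have q0 := bhD_sq_le (a - c) (b - c) v hv
  have e0 : bhD (a - c) (b - c) v = bhD v a b + bhD v b c + bhD v c a := by
    unfold bhD; simp only [PiLp.sub_apply]; ring
  rw [e0] at q0
  simp only [PiLp.sub_apply] at q0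
  set N := bhD v a b + bhD v b c + bhD v c a
  set X := bhD b a r1
  set Y := bhD c b r2
  set Z := bhD a c r3
  set A := a 0 ^ 2 + a 1 ^ 2 + a 2 ^ 2 with hA
  set B := b 0 ^ 2 + b 1 ^ 2 + b 2 ^ 2 with hB
  set C := c 0 ^ 2 + c 1 ^ 2 + c 2 ^ 2 with hC
  set P := (a 0 - b 0) ^ 2 + (a 1 - b 1) ^ 2 + (a 2 - b 2) ^ 2 with hP
  set Q := (b 0 - c 0) ^ 2 + (b 1 - c 1) ^ 2 + (b 2 - c 2) ^ 2 with hQ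
  set R := (c 0 - a 0) ^ 2 + (c 1 - a 1) ^ 2 + (c 2 - a 2) ^ 2 with hR
  have P0 : 0 ≤ P := by positivity
  have Q0 : 0 ≤ Q := by positivity
  have R0 : 0 ≤ R := by positivity
  have k0 : 4 * N ^ 2 ≤ 2 * (P * Q + Q * R + R * P) - (P ^ 2 + Q ^ 2 + R ^ 2) := by
    refine (mul_le_mul_of_nonneg_left q0 (by norm_num)).trans (le_of_eq ?_)
    rw [hP, hQ, hR]; ring
  have k1 : 4 * X ^ 2 ≤ 4 * P - P ^ 2 := by
    have : 4 * X ^ 2 ≤ -(A - B) ^ 2 + 2 * (A + B) * P - P ^ 2 := by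
      refine (mul_le_mul_of_nonneg_left q1 (by norm_num)).trans (le_of_eq ?_)
      rw [hP, hA, hB]; ring
    exact bh_tri_aux2 _ _ _ _ na nb P0 this
  have k2 : 4 * Y ^ 2 ≤ 4 * Q - Q ^ 2 := by
    have : 4 * Y ^ 2 ≤ -(B - C) ^ 2 + 2 * (B + C) * Q - Q ^ 2 := by
      refine (mul_le_mul_of_nonneg_left q2 (by norm_num)).trans (le_of_eq ?_)
      rw [hQ, hC, hB]; ring
    exact bh_tri_aux2 _ _ _ _ nb nc Q0 this
  have k3 : 4 * Z ^ 2 ≤ 4 * R - R ^ 2 := by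
    have : 4 * Z ^ 2 ≤ -(C - A) ^ 2 + 2 * (C + A) * R - R ^ 2 := by
      refine (mul_le_mul_of_nonneg_left q3 (by norm_num)).trans (le_of_eq ?_)
      rw [hR, hC, hA]; ring
    exact bh_tri_aux2 _ _ _ _ nc na R0 this
  exact bh_tri_aux N X Y Z P Q R k0 k1 k2 k3

/-- rotation of a triple -/
def bhrot (t : Fin 7 × Fin 7 × Fin 7) : Fin 7 × Fin 7 × Fin 7 := (t.2.1, t.2.2, t.1)

theorem bhrot3 (t : Fin 7 × Fin 7 × Fin 7) : bhrot (bhrot (bhrot t)) = t := rfl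

theorem bh_rotsum (O : Finset (Fin 7 × Fin 7 × Fin 7)) (hO : ∀ t ∈ O, bhrot t ∈ O)
    (h : Fin 7 × Fin 7 × Fin 7 → ℝ) : ∑ t ∈ O, h (bhrot t) = ∑ t ∈ O, h t := by
  refine Finset.sum_nbij' bhrot (fun t => bhrot (bhrot t)) hO (fun t ht => hO _ (hO _ ht)) ?_ ?_ ?_
  · intro t _; rfl
  · intro t _; rfl
  · intro t _; rfl

/-- a transversal function picks up a third of the sum -/
theorem bh_third (O : Finset (Fin 7 × Fin 7 × Fin 7)) (hO : ∀ t ∈ O, bhrot t ∈ O)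
    (g u : Fin 7 × Fin 7 × Fin 7 → ℝ) (hg : ∀ t, g (bhrot t) = g t) :
    ∑ t ∈ O, g t * (u t + u (bhrot t) + u (bhrot (bhrot t))) = 3 * ∑ t ∈ O, g t * u t := by
  have e1 := bh_rotsum O hO (fun t => g t * u t)
  have e2 := bh_rotsum O hO (fun t => g (bhrot t) * u (bhrot t))
  simp only [hg] at e1 e2
  simp only [mul_add, Finset.sum_add_distrib]
  linarith

open Classical in
theorem bh_weight (O T : Finset (Fin 7 × Fin 7 × Fin 7)) (hO : ∀ t ∈ O, bhrot t ∈ O) (hTO : T ⊆ O)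
    (hT : ∀ t ∈ T, bhrot t ∉ T) (g : Fin 7 × Fin 7 × Fin 7 → ℝ) (hg : ∀ t, g (bhrot t) = g t)
    (hg1 : ∀ t ∈ O, g t ≤ 1) :
    ∑ t ∈ O, g t ≤ (O.card : ℝ) - 3 * T.card + 3 * ∑ t ∈ T, g t := by
  set u : Fin 7 × Fin 7 × Fin 7 → ℝ := fun t => if t ∈ T then 1 else 0 with hu
  have e := bh_third O hO (fun t => g t - 1) u (by intro t; simp [hg])
  have e2 : ∑ t ∈ O, (g t - 1) * u t = ∑ t ∈ T, g t - T.card := by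
    simp only [hu, mul_ite, mul_one, mul_zero]
    rw [← Finset.sum_filter, Finset.filter_mem_eq_inter, Finset.inter_eq_right.2 hTO]
    simp
  have e3 : ∑ t ∈ O, (g t - 1) ≤ ∑ t ∈ O, (g t - 1) * (u t + u (bhrot t) + u (bhrot (bhrot t))) := by
    apply Finset.sum_le_sum
    intro t ht
    have h1 := hg1 t ht
    have hw : u t + u (bhrot t) + u (bhrot (bhrot t)) ≤ 1 := by
      have a1 := hT t
      have a2 := hT (bhrot t)
      have a3 := hT (bhrot (bhrot t))
      rw [bhrot3] at a3
      simp only [hu]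
      by_cases b1 : t ∈ T <;> by_cases b2 : bhrot t ∈ T <;> by_cases b3 : bhrot (bhrot t) ∈ T <;>
        simp_all
    nlinarith
  have e4 : ∑ t ∈ O, (g t - 1) = ∑ t ∈ O, g t - O.card := by simp
  rw [e4] at e3
  rw [e, e2] at e3
  linarith

/-- the middle predicate -/
def bhmid (z : Fin 7 → ℝ) (t : Fin 7 × Fin 7 × Fin 7) : Prop :=
  (z t.2.1 < z t.1 ∧ z t.1 < z t.2.2) ∨ (z t.2.2 < z t.1 ∧ z t.1 < z t.2.1)

open Classical in
theorem bh_mid_sum (z : Fin 7 → ℝ) (hz : Function.Injective z) (t : Fin 7 × Fin 7 × Fin 7)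
    (h1 : t.1 ≠ t.2.1) (h2 : t.2.1 ≠ t.2.2) (h3 : t.1 ≠ t.2.2) :
    (if bhmid z t then (1 : ℝ) else 0) + (if bhmid z (bhrot t) then (1 : ℝ) else 0) +
      (if bhmid z (bhrot (bhrot t)) then (1 : ℝ) else 0) = 1 := by
  have k1 : z t.1 ≠ z t.2.1 := fun h => h1 (hz h)
  have k2 : z t.2.1 ≠ z t.2.2 := fun h => h2 (hz h)
  have k3 : z t.1 ≠ z t.2.2 := fun h => h3 (hz h)
  simp only [bhmid, bhrot]
  rcases lt_or_gt_of_ne k1 with k1 | k1 <;> rcases lt_or_gt_of_ne k2 with k2 | k2 <;>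
    rcases lt_or_gt_of_ne k3 with k3 | k3 <;>
    first
    | (exfalso; linarith)
    | simp [k1, k2, k3, k1.not_gt, k2.not_gt, k3.not_gt]

open Classical in
theorem bh_mid_third (O : Finset (Fin 7 × Fin 7 × Fin 7)) (hO : ∀ t ∈ O, bhrot t ∈ O)
    (z : Fin 7 → ℝ) (hz : Function.Injective z)
    (hne : ∀ t ∈ O, t.1 ≠ t.2.1 ∧ t.2.1 ≠ t.2.2 ∧ t.1 ≠ t.2.2)
    (g : Fin 7 × Fin 7 × Fin 7 → ℝ) (hg : ∀ t, g (bhrot t) = g t) :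
    ∑ t ∈ O, g t = 3 * ∑ t ∈ O.filter (bhmid z), g t := by
  have e := bh_third O hO g (fun t => if bhmid z t then (1 : ℝ) else 0) hg
  rw [Finset.sum_filter]
  simp only [mul_ite, mul_one, mul_zero] at e
  rw [← e]
  apply Finset.sum_congr rfl
  intro t ht
  obtain ⟨h1, h2, h3⟩ := hne t ht
  rw [bh_mid_sum z hz t h1 h2 h3, mul_one]

open Classical in
theorem bh_count (O : Finset (Fin 7 × Fin 7 × Fin 7)) (hO : ∀ t ∈ O, bhrot t ∈ O)
    (z : Fin 7 → ℝ) (hz : Function.Injective z)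
    (hne : ∀ t ∈ O, t.1 ≠ t.2.1 ∧ t.2.1 ≠ t.2.2 ∧ t.1 ≠ t.2.2)
    (h1 : ∀ s ∈ O, ∀ t ∈ O, s.1 = t.1 → (z s.2.1 < z s.1 ∧ z s.1 < z s.2.2) →
      (z t.2.1 < z t.1 ∧ z t.1 < z t.2.2) → s = t)
    (h2 : ∀ s ∈ O, ∀ t ∈ O, s.1 = t.1 → (z s.2.2 < z s.1 ∧ z s.1 < z s.2.1) →
      (z t.2.2 < z t.1 ∧ z t.1 < z t.2.1) → s = t) :
    O.card ≤ 27 ∨ (O.card = 30 ∧ ∀ v, ∃ t ∈ O, t.1 = v) := by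
  set M := O.filter (bhmid z) with hM
  have hcard : O.card = 3 * M.card := by
    have := bh_mid_third O hO z hz hne (fun _ => 1) (fun _ => rfl)
    simp only [Finset.sum_const, nsmul_eq_mul, mul_one] at this
    exact_mod_cast this
  set U := O.image (fun t => t.1) with hU
  rcases O.eq_empty_or_nonempty with hemp | hnon
  · left; simp [hemp]
  have hUn : U.Nonempty := hnon.image _
  obtain ⟨top, htU, htop⟩ := Finset.exists_max_image U z hUn
  obtain ⟨bot, hbU, hbot⟩ := Finset.exists_min_image U z hUn
  have memU : ∀ t ∈ O, t.1 ∈ U ∧ t.2.1 ∈ U ∧ t.2.2 ∈ U := by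
    intro t ht
    refine ⟨Finset.mem_image_of_mem _ ht, ?_, ?_⟩
    · exact Finset.mem_image.2 ⟨bhrot t, hO _ ht, rfl⟩
    · exact Finset.mem_image.2 ⟨bhrot (bhrot t), hO _ (hO _ ht), rfl⟩
  have htb : top ≠ bot := by
    rintro rfl
    obtain ⟨t, ht⟩ := hnon
    obtain ⟨m1, m2, m3⟩ := memU t ht
    exact (hne t ht).1 (hz (le_antisymm ((htop _ m1).trans (hbot _ m2)) ((htop _ m2).trans (hbot _ m1))))
  have hmaps : ∀ t ∈ M, t.1 ∈ (U.erase top).erase bot := by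
    intro t ht
    obtain ⟨htO, hm⟩ := Finset.mem_filter.1 ht
    obtain ⟨m1, m2, m3⟩ := memU t htO
    rw [Finset.mem_erase, Finset.mem_erase]
    refine ⟨?_, ?_, m1⟩
    · intro h
      rcases hm with hm | hm
      · have := hbot _ m2; rw [← h] at this; linarith
      · have := hbot _ m3; rw [← h] at this; linarith
    · intro h
      rcases hm with hm | hm
      · have := htop _ m3; rw [← h] at this; linarith
      · have := htop _ m2; rw [← h] at this; linarith
  have hMle : M.card ≤ 2 * ((U.erase top).erase bot).card := by
    refine Finset.card_le_mul_card_image_of_maps_to hmaps 2 ?_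
    intro v hv
    have : M.filter (fun t => t.1 = v) ⊆
        (O.filter (fun t => t.1 = v ∧ z t.2.1 < z t.1 ∧ z t.1 < z t.2.2)) ∪
        (O.filter (fun t => t.1 = v ∧ z t.2.2 < z t.1 ∧ z t.1 < z t.2.1)) := by
      intro t ht
      simp only [Finset.mem_filter, Finset.mem_union, hM, bhmid] at ht ⊢
      tauto
    refine (Finset.card_le_card this).trans ((Finset.card_union_le _ _).trans ?_)
    have c1 : (O.filter (fun t => t.1 = v ∧ z t.2.1 < z t.1 ∧ z t.1 < z t.2.2)).card ≤ 1 := by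
      rw [Finset.card_le_one]
      intro s hs t ht
      simp only [Finset.mem_filter] at hs ht
      exact h1 s hs.1 t ht.1 (hs.2.1.trans ht.2.1.symm) hs.2.2 ht.2.2
    have c2 : (O.filter (fun t => t.1 = v ∧ z t.2.2 < z t.1 ∧ z t.1 < z t.2.1)).card ≤ 1 := by
      rw [Finset.card_le_one]
      intro s hs t ht
      simp only [Finset.mem_filter] at hs ht
      exact h2 s hs.1 t ht.1 (hs.2.1.trans ht.2.1.symm) hs.2.2 ht.2.2
    omega
  rw [Finset.card_erase_of_mem (by simp [hbU, htb.symm]), Finset.card_erase_of_mem htU] at hMle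
  by_cases hfull : ∀ v, v ∈ U
  · have hUu : U = Finset.univ := Finset.eq_univ_iff_forall.2 hfull
    rw [hUu, Finset.card_univ, Fintype.card_fin] at hMle
    by_cases h9 : M.card ≤ 9
    · left; omega
    · right
      refine ⟨by omega, fun v => ?_⟩
      obtain ⟨t, ht, h⟩ := Finset.mem_image.1 (hfull v)
      exact ⟨t, ht, h⟩
  · left
    have : U.card < (Finset.univ : Finset (Fin 7)).card := by
      apply Finset.card_lt_card
      rw [Finset.ssubset_univ_iff]
      intro h
      exact hfull (fun v => by rw [h]; exact Finset.mem_univ v)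
    rw [Finset.card_univ, Fintype.card_fin] at this
    omega

/-- orientation of four of the points -/
noncomputable def bhB (p : Fin 7 → bhE) (i j k l : Fin 7) : ℝ :=
  bhD (p i - p l) (p j - p l) (p k - p l)

/-- oriented supporting triangle -/
def bhR (p : Fin 7 → bhE) (i j k : Fin 7) : Prop :=
  i ≠ j ∧ j ≠ k ∧ i ≠ k ∧ ∀ l, l ≠ i → l ≠ j → l ≠ k → 0 < bhB p i j k l

/-- no four points coplanar -/
def bhGen (p : Fin 7 → bhE) : Prop :=
  ∀ i j k l, i ≠ j → i ≠ k → i ≠ l → j ≠ k → j ≠ l → k ≠ l → bhB p i j k l ≠ 0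

theorem bhB_rot (p : Fin 7 → bhE) (i j k l : Fin 7) : bhB p j k i l = bhB p i j k l := bhD_rot _ _ _

theorem bhB_swap12 (p : Fin 7 → bhE) (i j k l : Fin 7) : bhB p j i k l = - bhB p i j k l := by
  unfold bhB bhD; ring

theorem bhB_swap34 (p : Fin 7 → bhE) (i j k l : Fin 7) : bhB p i j l k = - bhB p i j k l := by
  unfold bhB bhD; simp only [PiLp.sub_apply]; ring

/-- in terms of vectors from the first point -/
theorem bhB_first (p : Fin 7 → bhE) (i j k l : Fin 7) :
    bhB p i j k l = - bhD (p j - p i) (p k - p i) (p l - p i) := by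
  unfold bhB bhD; simp only [PiLp.sub_apply]; ring

theorem bhR_rot (p : Fin 7 → bhE) (i j k : Fin 7) (h : bhR p i j k) : bhR p j k i := by
  obtain ⟨h1, h2, h3, h4⟩ := h
  refine ⟨h2, h3.symm, h1.symm, fun l a b c => ?_⟩
  rw [bhB_rot]; exact h4 l c a b

theorem bhR_un (p : Fin 7 → bhE) (i j k l : Fin 7) (h : bhR p i j k) (h' : bhR p i j l) : k = l := by
  by_contra hkl
  have a := h.2.2.2 l h'.2.2.1.symm h'.2.1.symm (Ne.symm hkl)
  have b := h'.2.2.2 k h.2.2.1.symm h.2.1.symm hkl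
  rw [bhB_swap34] at b
  linarith

theorem bh_fresh (i j k : Fin 7) : ∃ l : Fin 7, l ≠ i ∧ l ≠ j ∧ l ≠ k := by
  revert i j k; decide

theorem bhR_no (p : Fin 7 → bhE) (i j k : Fin 7) (h : bhR p i j k) : ¬ bhR p j i k := by
  intro h'
  obtain ⟨l, h1, h2, h3⟩ := bh_fresh i j k
  have a := h.2.2.2 l h1 h2 h3
  have b := h'.2.2.2 l h2 h1 h3
  rw [bhB_swap12] at b
  linarith

theorem bh_plucker (e k n l m : bhE) :
    bhD e k n * bhD e l m = bhD e k l * bhD e n m - bhD e k m * bhD e n l := by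
  unfold bhD; ring

theorem bhR_opp (p : Fin 7 → bhE) (hgen : bhGen p) (i j k : Fin 7) (h : bhR p i j k) :
    ∃ l, bhR p j i l := by
  obtain ⟨n, n1, n2, n3⟩ := bh_fresh i j k
  obtain ⟨hij, hjk, hik, hpos⟩ := h
  let S : Finset (Fin 7) := Finset.univ.filter (fun l => l ≠ i ∧ l ≠ j ∧ l ≠ k)
  have hS : S.Nonempty := ⟨n, by simp [S, n1, n2, n3]⟩
  obtain ⟨l, hl, hmax⟩ := Finset.exists_max_image S (fun l => bhB p i j n l / bhB p i j k l) hS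
  have hlS : l ≠ i ∧ l ≠ j ∧ l ≠ k := by simpa [S] using hl
  obtain ⟨l1, l2, l3⟩ := hlS
  have kl := hpos l l1 l2 l3
  have kn := hpos n n1 n2 n3
  refine ⟨l, hij.symm, l1.symm, l2.symm, fun m m1 m2 m3 => ?_⟩
  rw [bhB_swap12, neg_pos]
  by_cases hmk : m = k
  · subst hmk; rw [bhB_swap34]; linarith
  · have km := hpos m m2 m1 hmk
    have hm := hmax m (by simp [S, m1, m2, hmk])
    rw [div_le_div_iff₀ km kl] at hm
    have pl : bhB p i j k n * bhB p i j l m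
        = bhB p i j k l * bhB p i j n m - bhB p i j k m * bhB p i j n l := by
      simp only [bhB_first]
      have := bh_plucker (p j - p i) (p k - p i) (p n - p i) (p l - p i) (p m - p i)
      linarith
    have hne : bhB p i j l m ≠ 0 := hgen _ _ _ _ hij l1.symm m2.symm l2.symm m1.symm m3.symm
    refine lt_of_le_of_ne ?_ hne
    by_contra hc
    push Not at hc
    have := mul_pos kn hc
    nlinarith

theorem bh_cramer (v a b c m n : bhE) :
    bhD b a c * bhD v m n + bhD v b c * bhD a m n + bhD v c a * bhD b m n + bhD v a b * bhD c m n = 0 := by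
  unfold bhD; ring

theorem bhR_tetra (p : Fin 7 → bhE) (v a b c l m n : Fin 7) (h1 : bhR p v a b) (h2 : bhR p v b c)
    (h3 : bhR p v c a) (h4 : bhR p b a c) (hl : bhR p l m n) (lv : l ≠ v) (la : l ≠ a) (lb : l ≠ b)
    (lc : l ≠ c) : False := by
  have w1 := h1.2.2.2 l lv la lb
  have w2 := h2.2.2.2 l lv lb lc
  have w3 := h3.2.2.2 l lv lc la
  have w4 := h4.2.2.2 l lb la lc
  have f : ∀ t, t ≠ l → (t ≠ m → t ≠ n → bhD (p t - p l) (p m - p l) (p n - p l) < 0) ∧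
      bhD (p t - p l) (p m - p l) (p n - p l) ≤ 0 := by
    intro t ht
    have key : t ≠ m → t ≠ n → bhD (p t - p l) (p m - p l) (p n - p l) < 0 := by
      intro tm tn
      have := hl.2.2.2 t ht tm tn
      rw [bhB_first] at this
      rw [← bhD_rot]; linarith
    refine ⟨key, ?_⟩
    by_cases tm : t = m
    · subst tm; unfold bhD; apply le_of_eq; ring
    by_cases tn : t = n
    · subst tn; unfold bhD; apply le_of_eq; ring
    exact (key tm tn).le
  obtain ⟨sv, fv⟩ := f v lv.symm
  obtain ⟨sa, fa⟩ := f a la.symm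
  obtain ⟨sb, fb⟩ := f b lb.symm
  obtain ⟨sc, fc⟩ := f c lc.symm
  have id := bh_cramer (p v - p l) (p a - p l) (p b - p l) (p c - p l) (p m - p l) (p n - p l)
  unfold bhB at w1 w2 w3 w4
  have e1 := mul_nonpos_of_nonneg_of_nonpos w4.le fv
  have e2 := mul_nonpos_of_nonneg_of_nonpos w2.le fa
  have e3 := mul_nonpos_of_nonneg_of_nonpos w3.le fb
  have e4 := mul_nonpos_of_nonneg_of_nonpos w1.le fc
  have hva := h1.1
  have hab := h1.2.1
  have hvb := h1.2.2.1
  by_cases A : v ≠ m ∧ v ≠ n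
  · have := mul_neg_of_pos_of_neg w4 (sv A.1 A.2); linarith
  by_cases B : a ≠ m ∧ a ≠ n
  · have := mul_neg_of_pos_of_neg w2 (sa B.1 B.2); linarith
  by_cases C : b ≠ m ∧ b ≠ n
  · have := mul_neg_of_pos_of_neg w3 (sb C.1 C.2); linarith
  grind

theorem bh_zid (a b c d : bhE) :
    a 2 * bhD c d b - b 2 * bhD c d a + c 2 * bhD a b d - d 2 * bhD a b c = 0 := by
  unfold bhD; ring

theorem bhR_mid (p : Fin 7 → bhE) (v a b c d : Fin 7) (h : bhR p v a b) (h' : bhR p v c d)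
    (s : ℝ) (ha : 0 < s * (p v 2 - p a 2)) (hb : 0 < s * (p b 2 - p v 2))
    (hc : 0 < s * (p v 2 - p c 2)) (hd : 0 < s * (p d 2 - p v 2)) : a = c ∧ b = d := by
  by_cases ac : a = c
  · subst ac; exact ⟨rfl, bhR_un p _ _ _ _ h h'⟩
  by_cases bd : b = d
  · subst bd
    exact ⟨bhR_un p _ _ _ _ (bhR_rot p _ _ _ (bhR_rot p _ _ _ h)) (bhR_rot p _ _ _ (bhR_rot p _ _ _ h')), rfl⟩
  have ad : a ≠ d := by rintro rfl; linarith
  have bc : b ≠ c := by rintro rfl; linarith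
  exfalso
  have k1 := h.2.2.2 c h'.1.symm (Ne.symm ac) bc.symm
  have k2 := h.2.2.2 d h'.2.2.1.symm ad.symm (Ne.symm bd)
  have k3 := h'.2.2.2 a h.1.symm ac ad
  have k4 := h'.2.2.2 b h.2.2.1.symm bc bd
  rw [bhB_first] at k1 k2 k3 k4
  have id := bh_zid (p a - p v) (p b - p v) (p c - p v) (p d - p v)
  simp only [PiLp.sub_apply] at id
  have e1 := mul_pos ha k4
  have e2 := mul_pos hb k3
  have e3 := mul_pos hc k2
  have e4 := mul_pos hd k1
  have : s * ((p a 2 - p v 2) * bhD (p c - p v) (p d - p v) (p b - p v) -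
        (p b 2 - p v 2) * bhD (p c - p v) (p d - p v) (p a - p v) +
      (p c 2 - p v 2) * bhD (p a - p v) (p b - p v) (p d - p v) -
    (p d 2 - p v 2) * bhD (p a - p v) (p b - p v) (p c - p v)) = 0 := by rw [id, mul_zero]
  linarith

open Classical in
/-- the oriented facets -/
noncomputable def bhO (p : Fin 7 → bhE) : Finset (Fin 7 × Fin 7 × Fin 7) :=
  Finset.univ.filter (fun t => bhR p t.1 t.2.1 t.2.2)

theorem bhO_mem (p : Fin 7 → bhE) (t : Fin 7 × Fin 7 × Fin 7) : t ∈ bhO p ↔ bhR p t.1 t.2.1 t.2.2 := by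
  simp [bhO]

theorem bhO_rot (p : Fin 7 → bhE) : ∀ t ∈ bhO p, bhrot t ∈ bhO p := by
  intro t ht
  rw [bhO_mem] at ht ⊢
  exact bhR_rot p _ _ _ ht

/-- the volume form of a triple -/
noncomputable def bhg (p : Fin 7 → bhE) (t : Fin 7 × Fin 7 × Fin 7) : ℝ := bhD (p t.1) (p t.2.1) (p t.2.2)

open Classical in
theorem bh_star_sum (p : Fin 7 → bhE) (x a b c d e : Fin 7) (nb : Finset (Fin 7))
    (hnb : ∀ a, a ∈ nb ↔ ∃ b, bhR p x a b)
    (h1 : bhR p x a b) (h2 : bhR p x b c) (h3 : bhR p x c d) (h4 : bhR p x d e) (h5 : bhR p x e a)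
    (hn : nb = {a, b, c, d, e}) (hd : [a, b, c, d, e].Nodup) (hp : ∀ i, ‖p i‖ ≤ 1) :
    ((bhO p).filter (fun t => t.1 = x)).card = 5 ∧
    ∑ t ∈ (bhO p).filter (fun t => t.1 = x), bhg p t ≤ 5 * sin (2 * π / 5) := by
  have e0 : (bhO p).filter (fun t => t.1 = x) = {(x, a, b), (x, b, c), (x, c, d), (x, d, e), (x, e, a)} := by
    ext ⟨t1, t2, t3⟩
    simp only [Finset.mem_filter, bhO_mem, Finset.mem_insert, Finset.mem_singleton, Prod.mk.injEq]
    constructor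
    · rintro ⟨h, rfl⟩
      have : t2 ∈ nb := (hnb t2).2 ⟨t3, h⟩
      rw [hn] at this
      simp only [Finset.mem_insert, Finset.mem_singleton] at this
      rcases this with rfl | rfl | rfl | rfl | rfl
      · exact Or.inl ⟨rfl, rfl, bhR_un p _ _ _ _ h h1⟩
      · exact Or.inr (Or.inl ⟨rfl, rfl, bhR_un p _ _ _ _ h h2⟩)
      · exact Or.inr (Or.inr (Or.inl ⟨rfl, rfl, bhR_un p _ _ _ _ h h3⟩))
      · exact Or.inr (Or.inr (Or.inr (Or.inl ⟨rfl, rfl, bhR_un p _ _ _ _ h h4⟩)))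
      · exact Or.inr (Or.inr (Or.inr (Or.inr ⟨rfl, rfl, bhR_un p _ _ _ _ h h5⟩)))
    · rintro (⟨rfl, rfl, rfl⟩ | ⟨rfl, rfl, rfl⟩ | ⟨rfl, rfl, rfl⟩ | ⟨rfl, rfl, rfl⟩ | ⟨rfl, rfl, rfl⟩)
      all_goals exact ⟨by assumption, rfl⟩
  simp only [List.nodup_cons, List.mem_cons, List.not_mem_nil, or_false, not_or] at hd
  obtain ⟨⟨q1, q2, q3, q4⟩, ⟨q5, q6, q7⟩, ⟨q8, q9⟩, q10, _⟩ := hd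
  rw [e0]
  constructor
  · rw [Finset.card_insert_of_notMem, Finset.card_insert_of_notMem, Finset.card_insert_of_notMem,
      Finset.card_insert_of_notMem, Finset.card_singleton] <;> simp [q1, q2, q3, q4, q5, q6, q7, q8, q9, q10]
  · rw [Finset.sum_insert, Finset.sum_insert, Finset.sum_insert, Finset.sum_insert, Finset.sum_singleton]
    · have := bh_star5 (p x) (p a) (p b) (p c) (p d) (p e) (hp _) (hp _) (hp _) (hp _) (hp _) (hp _)
      simp only [bhg]
      linarith
    all_goals simp [q1, q2, q3, q4, q5, q6, q7, q8, q9, q10]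

open Classical in
theorem bh_sum_bound (p : Fin 7 → bhE) (hp : ∀ i, ‖p i‖ ≤ 1) (hgen : bhGen p)
    (hz : Function.Injective (fun i => p i 2)) :
    ∑ t ∈ bhO p, bhg p t ≤ 30 * sin (2 * π / 5) := by
  have hne : ∀ t ∈ bhO p, t.1 ≠ t.2.1 ∧ t.2.1 ≠ t.2.2 ∧ t.1 ≠ t.2.2 := by
    intro t ht
    rw [bhO_mem] at ht
    exact ⟨ht.1, ht.2.1, ht.2.2.1⟩
  have hg : ∀ t, bhg p (bhrot t) = bhg p t := fun t => bhD_rot _ _ _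
  have hg1 : ∀ t ∈ bhO p, bhg p t ≤ 1 := fun t _ => bhD_le_one _ _ _ (hp _) (hp _) (hp _)
  have hs := bh_sin_lb
  have hcount := bh_count (bhO p) (bhO_rot p) (fun i => p i 2) hz hne (by
      rintro ⟨v, a, b⟩ hs ⟨v', c, d⟩ ht h h1 h2
      rw [bhO_mem] at hs ht
      simp only at h h1 h2 hs ht
      subst h
      obtain ⟨r1, r2⟩ := bhR_mid p v a b c d hs ht 1 (by linarith) (by linarith) (by linarith) (by linarith)
      rw [r1, r2]) (by
      rintro ⟨v, a, b⟩ hs ⟨v', c, d⟩ ht h h1 h2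
      rw [bhO_mem] at hs ht
      simp only at h h1 h2 hs ht
      subst h
      obtain ⟨r1, r2⟩ := bhR_mid p v a b c d hs ht (-1) (by linarith) (by linarith) (by linarith) (by linarith)
      rw [r1, r2])
  rcases hcount with h27 | ⟨h30, hused⟩
  · have : ∑ t ∈ bhO p, bhg p t ≤ (bhO p).card := by
      refine (Finset.sum_le_sum hg1).trans ?_
      simp
    have h27' : ((bhO p).card : ℝ) ≤ 27 := by exact_mod_cast h27
    linarith
  by_cases h3 : ∀ v a b c, bhR p v a b → bhR p v b c → ¬ bhR p v c a
  · set nb : Fin 7 → Finset (Fin 7) := fun v => Finset.univ.filter (fun a => ∃ b, bhR p v a b) with hnbdef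
    have hnb : ∀ v a, a ∈ nb v ↔ ∃ b, bhR p v a b := by intro v a; simp [nb]
    have hcl := bh_classify (bhR p) (fun v => (nb v).card) nb (fun _ => rfl) hnb (bhR_rot p) (bhR_un p)
      (bhR_opp p hgen) (fun i j k h => ⟨h.1, h.2.1, h.2.2.1⟩) (bhR_no p) (by
        intro v
        obtain ⟨t, ht, h⟩ := hused v
        rw [bhO_mem] at ht
        subst h
        exact ⟨t.2.1, (hnb _ _).2 ⟨_, ht⟩⟩) (by
        rw [← h30, Finset.card_eq_sum_card_fiberwise (f := fun t => t.1) (t := Finset.univ) (by intro t _; simp)]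
        apply Finset.sum_congr rfl
        intro v _
        symm
        apply Finset.card_nbij (fun t => t.2.1)
        · intro t ht
          simp only [Finset.coe_filter, Set.mem_ofPred_eq, bhO_mem] at ht
          obtain ⟨h, rfl⟩ := ht
          exact Finset.mem_coe.2 ((hnb _ _).2 ⟨_, h⟩)
        · rintro ⟨s1, s2, s3⟩ hs ⟨t1, t2, t3⟩ ht h
          simp only [Finset.coe_filter, Set.mem_ofPred_eq, bhO_mem] at hs ht h
          obtain ⟨h1, rfl⟩ := hs
          obtain ⟨h2, rfl⟩ := ht
          subst h
          rw [bhR_un p _ _ _ _ h1 h2]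
        · intro a ha
          obtain ⟨b, hb⟩ := (hnb _ _).1 (Finset.mem_coe.1 ha)
          refine ⟨(v, a, b), ?_, rfl⟩
          simp only [Finset.coe_filter, Set.mem_ofPred_eq, bhO_mem]
          exact ⟨hb, trivial⟩) h3
    obtain ⟨x, x', hxx, hxn, _, _, ⟨a, b, c, d, e, r1, r2, r3, r4, r5, hn, hd⟩,
      ⟨a', b', c', d', e', r1', r2', r3', r4', r5', hn', hd'⟩⟩ := hcl
    obtain ⟨c1, s1⟩ := bh_star_sum p x a b c d e (nb x) (hnb x) r1 r2 r3 r4 r5 hn hd hp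
    obtain ⟨c2, s2⟩ := bh_star_sum p x' a' b' c' d' e' (nb x') (hnb x') r1' r2' r3' r4' r5' hn' hd' hp
    set T := (bhO p).filter (fun t => t.1 = x) ∪ (bhO p).filter (fun t => t.1 = x') with hT
    have hdis : Disjoint ((bhO p).filter (fun t => t.1 = x)) ((bhO p).filter (fun t => t.1 = x')) := by
      rw [Finset.disjoint_left]
      intro t h1 h2
      simp only [Finset.mem_filter] at h1 h2
      exact hxx (h1.2.symm.trans h2.2)
    have hw := bh_weight (bhO p) T (bhO_rot p)
      (Finset.union_subset (Finset.filter_subset _ _) (Finset.filter_subset _ _)) (by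
        intro t h1 h2
        simp only [hT, Finset.mem_union, Finset.mem_filter, bhO_mem, bhrot] at h1 h2
        have hn1 : ¬ ∃ b, bhR p x x' b := fun h => hxn ((hnb _ _).2 h)
        have hn2 : ¬ ∃ b, bhR p x' x b := fun ⟨b, h⟩ => hn1 (bhR_opp p hgen _ _ _ h)
        rcases h1 with ⟨h1, k1⟩ | ⟨h1, k1⟩ <;> rcases h2 with ⟨h2, k2⟩ | ⟨h2, k2⟩ <;> rw [k1, k2] at h1
        · exact h1.1 rfl
        · exact hn1 ⟨_, h1⟩
        · exact hn2 ⟨_, h1⟩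
        · exact h1.1 rfl) (bhg p) hg hg1
    rw [hT, Finset.card_union_of_disjoint hdis, Finset.sum_union hdis, c1, c2, h30] at hw
    push_cast at hw
    linarith
  · push Not at h3
    obtain ⟨v, a, b, c, hab, hbc, hca⟩ := h3
    obtain ⟨r1, k1⟩ := bhR_opp p hgen a b v (bhR_rot p _ _ _ hab)
    obtain ⟨r2, k2⟩ := bhR_opp p hgen b c v (bhR_rot p _ _ _ hbc)
    obtain ⟨r3, k3⟩ := bhR_opp p hgen c a v (bhR_rot p _ _ _ hca)
    have hbac : ¬ bhR p b a c := by
      intro h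
      have : ∃ l : Fin 7, l ≠ v ∧ l ≠ a ∧ l ≠ b ∧ l ≠ c := by
        clear * -
        revert v a b c; decide
      obtain ⟨l, l1, l2, l3, l4⟩ := this
      obtain ⟨t, ht, hl⟩ := hused l
      rw [bhO_mem, hl] at ht
      exact bhR_tetra p v a b c _ _ _ hab hbc hca h ht l1 l2 l3 l4
    have q1 : r1 ≠ c := by rintro rfl; exact hbac k1
    have q2 : r2 ≠ a := by rintro rfl; exact hbac (bhR_rot p _ _ _ k2)
    have q3 : r3 ≠ b := by rintro rfl; exact hbac (bhR_rot p _ _ _ (bhR_rot p _ _ _ k3))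
    have va := hab.1
    have vb := hbc.1
    have vc := hca.1
    have ab := hab.2.1
    have bc := hbc.2.1
    have ca := hca.2.1
    have key := bh_tri (p v) (p a) (p b) (p c) (p r1) (p r2) (p r3) (hp _) (hp _) (hp _) (hp _) (hp _) (hp _) (hp _)
    set T : Finset (Fin 7 × Fin 7 × Fin 7) :=
      {(v, a, b), (v, b, c), (v, c, a), (b, a, r1), (c, b, r2), (a, c, r3)} with hT
    have hTO : T ⊆ bhO p := by
      intro t ht
      simp only [hT, Finset.mem_insert, Finset.mem_singleton] at ht
      rw [bhO_mem]
      rcases ht with rfl | rfl | rfl | rfl | rfl | rfl <;> assumption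
    have hTr : ∀ t ∈ T, bhrot t ∉ T := by
      intro t ht
      simp only [hT, Finset.mem_insert, Finset.mem_singleton] at ht ⊢
      rcases ht with rfl | rfl | rfl | rfl | rfl | rfl <;>
        simp [bhrot, q1, q2, q3, va, vb, vc, ab, bc, ca, va.symm, vb.symm, vc.symm, ab.symm, bc.symm, ca.symm]
    have hcard : T.card = 6 := by
      rw [hT, Finset.card_insert_of_notMem, Finset.card_insert_of_notMem, Finset.card_insert_of_notMem,
        Finset.card_insert_of_notMem, Finset.card_insert_of_notMem, Finset.card_singleton] <;>
      simp [va, vb, vc, ab, bc, ca, va.symm, vb.symm, vc.symm, ab.symm, bc.symm, ca.symm]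
    have hsum : ∑ t ∈ T, bhg p t ≤ 3 * √3 := by
      rw [hT, Finset.sum_insert, Finset.sum_insert, Finset.sum_insert, Finset.sum_insert, Finset.sum_insert,
        Finset.sum_singleton]
      · simp only [bhg]; linarith
      all_goals simp [va, vb, vc, ab, bc, ca, va.symm, vb.symm, vc.symm, ab.symm, bc.symm, ca.symm]
    have hw := bh_weight (bhO p) T (bhO_rot p) hTO hTr (bhg p) hg hg1
    rw [hcard, h30] at hw
    push_cast at hw
    have h3 : √3 ≤ 1.75 := Real.sqrt_le_iff.2 ⟨by norm_num, by norm_num⟩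
    linarith

/-- flip the sign of one coordinate -/
def bhflip (i : Fin 3) (x : Fin 3 → ℝ) : Fin 3 → ℝ := fun j => (if j = i then (fun y : ℝ => -y) else id) (x j)

theorem bhflip_mp (i : Fin 3) : MeasurePreserving (bhflip i) volume volume := by
  unfold bhflip
  apply volume_preserving_pi (f := fun j => if j = i then (fun y : ℝ => -y) else id)
  intro j
  by_cases h : j = i
  · simp only [h, if_true]; exact Measure.measurePreserving_neg _
  · simp only [h, if_false]; exact MeasurePreserving.id _

theorem bh_half (i : Fin 3) (W : Set (Fin 3 → ℝ)) (hW : MeasurableSet W)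
    (hinv : ∀ x, bhflip i x ∈ W ↔ x ∈ W) : 2 * volume (W ∩ {x | 0 < x i}) ≤ volume W := by
  have m1 : MeasurableSet (W ∩ {x | 0 < x i}) :=
    hW.inter (measurableSet_lt measurable_const (measurable_pi_apply i))
  have e : bhflip i ⁻¹' (W ∩ {x | 0 < x i}) = W ∩ {x | x i < 0} := by
    ext x
    simp only [Set.mem_preimage, Set.mem_inter_iff, hinv]
    simp [bhflip]
  have m2 : MeasurableSet (W ∩ {x | x i < 0}) :=
    hW.inter (measurableSet_lt (measurable_pi_apply i) measurable_const)
  have v2 : volume (W ∩ {x | x i < 0}) = volume (W ∩ {x | 0 < x i}) := by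
    rw [← e, (bhflip_mp i).measure_preimage m1.nullMeasurableSet]
  have hd : Disjoint (W ∩ {x | 0 < x i}) (W ∩ {x | x i < 0}) := by
    rw [Set.disjoint_left]
    rintro x ⟨_, h1⟩ ⟨_, h2⟩
    simp only [Set.mem_ofPred_eq] at h1 h2
    linarith
  calc 2 * volume (W ∩ {x | 0 < x i}) = volume (W ∩ {x | 0 < x i}) + volume (W ∩ {x | x i < 0}) := by
        rw [v2, two_mul]
    _ = volume ((W ∩ {x | 0 < x i}) ∪ (W ∩ {x | x i < 0})) := (measure_union hd m2).symm
    _ ≤ volume W := measure_mono (by intro x hx; rcases hx with h | h <;> exact h.1)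

theorem bh_octa : volume {x : Fin 3 → ℝ | |x 0| + |x 1| + |x 2| ≤ 1} = ENNReal.ofReal (8 / 6) := by
  have := volume_sum_rpow_le (Fin 3) (le_refl (1 : ℝ)) 1
  simp only [Fin.sum_univ_three, rpow_one, div_one] at this
  rw [this]
  have g2 : Gamma (1 + 1) = 1 := by
    have := Real.Gamma_nat_eq_factorial 1; simpa using this
  have g4 : Gamma ((Fintype.card (Fin 3) : ℕ) + 1) = 6 := by
    rw [Real.Gamma_nat_eq_factorial]; norm_num [Nat.factorial]
  rw [g2, g4]
  norm_num

theorem bh_simplex_pi : volume {x : Fin 3 → ℝ | (∀ i, 0 ≤ x i) ∧ x 0 + x 1 + x 2 ≤ 1} ≤ ENNReal.ofReal (1 / 6) := by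
  set W := {x : Fin 3 → ℝ | |x 0| + |x 1| + |x 2| ≤ 1} with hW
  have mW : MeasurableSet W := by
    apply measurableSet_le _ measurable_const
    fun_prop
  have mp : ∀ i, MeasurableSet {x : Fin 3 → ℝ | 0 < x i} := fun i =>
    measurableSet_lt measurable_const (measurable_pi_apply i)
  have i0 := bh_half 0 W mW (by intro x; simp [hW, bhflip])
  have i1 := bh_half 1 (W ∩ {x | 0 < x 0}) (mW.inter (mp 0)) (by intro x; simp [hW, bhflip])
  have i2 := bh_half 2 (W ∩ {x | 0 < x 0} ∩ {x | 0 < x 1}) ((mW.inter (mp 0)).inter (mp 1))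
    (by intro x; simp [hW, bhflip])
  have hS : volume {x : Fin 3 → ℝ | (∀ i, 0 ≤ x i) ∧ x 0 + x 1 + x 2 ≤ 1} ≤
      volume (W ∩ {x | 0 < x 0} ∩ {x | 0 < x 1} ∩ {x | 0 < x 2}) := by
    apply measure_mono_ae
    have a := fun i => Measure.ae_eval_ne (fun _ : Fin 3 => (volume : Measure ℝ)) i 0
    filter_upwards [a 0, a 1, a 2] with x h0 h1 h2 hx
    obtain ⟨hp, hs⟩ := hx
    have q0 := hp 0
    have q1 := hp 1
    have q2 := hp 2
    refine ⟨⟨⟨?_, lt_of_le_of_ne q0 h0.symm⟩, lt_of_le_of_ne q1 h1.symm⟩, lt_of_le_of_ne q2 h2.symm⟩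
    change |x 0| + |x 1| + |x 2| ≤ 1
    rw [abs_of_nonneg q0, abs_of_nonneg q1, abs_of_nonneg q2]; exact hs
  refine hS.trans ?_
  set X := volume (W ∩ {x | 0 < x 0} ∩ {x | 0 < x 1} ∩ {x | 0 < x 2})
  have h8 : 8 * X ≤ ENNReal.ofReal (8 / 6) := by
    rw [← bh_octa]
    calc 8 * X = 2 * (2 * (2 * X)) := by rw [← mul_assoc, ← mul_assoc]; norm_num
      _ ≤ 2 * (2 * volume (W ∩ {x | 0 < x 0} ∩ {x | 0 < x 1})) := by gcongr
      _ ≤ 2 * volume (W ∩ {x | 0 < x 0}) := by gcongr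
      _ ≤ volume W := i0
  have : ENNReal.ofReal (8 / 6) = 8 * ENNReal.ofReal (1 / 6) := by
    rw [show (8 : ENNReal) = ENNReal.ofReal 8 by norm_num, ← ENNReal.ofReal_mul (by norm_num)]; norm_num
  rw [this] at h8
  exact (ENNReal.mul_le_mul_iff_right (by norm_num) (by norm_num)).1 h8

theorem bh_simplex (q a b c : bhE) :
    volume (convexHull ℝ ({q, a, b, c} : Set bhE)) ≤ ENNReal.ofReal (|bhD (a - q) (b - q) (c - q)| / 6) := by
  set S : Set bhE := {x : bhE | (∀ i, 0 ≤ x i) ∧ x 0 + x 1 + x 2 ≤ 1} with hS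
  have vS : volume S ≤ ENNReal.ofReal (1 / 6) := by
    refine le_trans (le_of_eq ?_) bh_simplex_pi
    rw [← (PiLp.volume_preserving_ofLp (Fin 3)).measure_preimage]
    · rfl
    · apply MeasurableSet.nullMeasurableSet
      apply MeasurableSet.inter
      · have : {a : Fin 3 → ℝ | ∀ i, 0 ≤ a i} = ⋂ i, {a | 0 ≤ a i} := by ext; simp
        change MeasurableSet {a : Fin 3 → ℝ | ∀ i, 0 ≤ a i}
        rw [this]
        exact MeasurableSet.iInter fun i => measurableSet_le measurable_const (measurable_pi_apply i)
      · change MeasurableSet {x : Fin 3 → ℝ | x 0 + x 1 + x 2 ≤ 1}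
        apply measurableSet_le _ measurable_const
        fun_prop
  set M : Matrix (Fin 3) (Fin 3) ℝ := Matrix.of ![![(a - q) 0, (b - q) 0, (c - q) 0],
    ![(a - q) 1, (b - q) 1, (c - q) 1], ![(a - q) 2, (b - q) 2, (c - q) 2]] with hM
  let bs := (EuclideanSpace.basisFun (Fin 3) ℝ).toBasis
  set f : bhE →ₗ[ℝ] bhE := Matrix.toLin bs bs M with hf
  have hdet : LinearMap.det f = bhD (a - q) (b - q) (c - q) := by
    rw [hf, LinearMap.det_toLin, Matrix.det_fin_three]
    simp [hM, bhD]; ring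
  have hfx : ∀ x : bhE, f x = x 0 • (a - q) + x 1 • (b - q) + x 2 • (c - q) := by
    intro x
    rw [hf, Matrix.toLin_apply]
    ext i
    fin_cases i <;> simp [bs, Fin.sum_univ_three, Matrix.mulVec, dotProduct, hM] <;> ring
  have hsub : convexHull ℝ ({q, a, b, c} : Set bhE) ⊆ (fun x => q + x) '' (f '' S) := by
    apply convexHull_min
    · rintro x (rfl | rfl | rfl | rfl)
      · exact ⟨0, ⟨0, by simp [hS], by simp⟩, by simp⟩
      · exact ⟨x - q, ⟨EuclideanSpace.single 0 1, by constructor; intro i; fin_cases i <;> simp; simp, by simp [hfx]⟩, by simp⟩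
      · exact ⟨x - q, ⟨EuclideanSpace.single 1 1, by constructor; intro i; fin_cases i <;> simp; simp, by simp [hfx]⟩, by simp⟩
      · exact ⟨x - q, ⟨EuclideanSpace.single 2 1, by constructor; intro i; fin_cases i <;> simp; simp, by simp [hfx]⟩, by simp⟩
    · apply Convex.translate
      apply Convex.is_linear_image _ f.isLinear
      intro x hx y hy s t hs ht hst
      refine ⟨fun i => ?_, ?_⟩
      · simp only [PiLp.add_apply, PiLp.smul_apply, smul_eq_mul]
        exact add_nonneg (mul_nonneg hs (hx.1 i)) (mul_nonneg ht (hy.1 i))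
      · simp only [PiLp.add_apply, PiLp.smul_apply, smul_eq_mul]
        have := mul_le_mul_of_nonneg_left hx.2 hs
        have := mul_le_mul_of_nonneg_left hy.2 ht
        linarith
  refine (measure_mono hsub).trans ?_
  rw [Set.image_add_left, measure_preimage_add, Measure.addHaar_image_linearMap, hdet]
  calc _ ≤ ENNReal.ofReal |bhD (a - q) (b - q) (c - q)| * ENNReal.ofReal (1 / 6) := by gcongr
    _ = _ := by rw [← ENNReal.ofReal_mul (abs_nonneg _)]; congr 1; ring

theorem bh_vec (a b c w : bhE) :
    bhD a b c • w = bhD w b c • a + bhD a w c • b + bhD a b w • c := by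
  ext i
  fin_cases i <;> simp [bhD] <;> ring

theorem bh_ker (f : bhE →L[ℝ] ℝ) (a b c w : bhE) (ha : f a = 0) (hb : f b = 0) :
    bhD a b c * f w = bhD a b w * f c := by
  have := congrArg f (bh_vec a b c w)
  simp only [map_add, map_smul, ha, hb, smul_eq_mul, mul_zero, zero_add] at this
  exact this

theorem bh_null (q a b : bhE) : volume (affineSpan ℝ ({q, a, b} : Set bhE) : Set bhE) = 0 := by
  apply Measure.addHaar_affineSubspace
  intro h
  have h2 := (coplanar_triple ℝ q a b).finrank_le_two
  rw [← direction_affineSpan, h, AffineSubspace.direction_top, finrank_top] at h2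
  simp at h2

theorem bh_exit (P : Set bhE) (hP : IsCompact P) (q x : bhE) (hx : x ∈ P) (hxq : x ≠ q) :
    ∃ s : ℝ, 1 ≤ s ∧ q + s • (x - q) ∈ P ∧ q + s • (x - q) ∉ interior P := by
  let φ : ℝ → bhE := fun s => q + s • (x - q)
  have hφ : Continuous φ := by fun_prop
  set K := φ ⁻¹' P with hK
  have hKc : IsClosed K := hP.isClosed.preimage hφ
  have h1 : (1 : ℝ) ∈ K := by simp [hK, φ, hx]
  have hpos : 0 < ‖x - q‖ := norm_pos_iff.2 (sub_ne_zero.2 hxq)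
  obtain ⟨R, hR⟩ := hP.isBounded.exists_norm_le
  have hb : BddAbove K := by
    refine ⟨(R + ‖q‖) / ‖x - q‖, fun s hs => ?_⟩
    rw [le_div_iff₀ hpos]
    have h2 := hR _ hs
    have h3 : ‖s • (x - q)‖ ≤ ‖q + s • (x - q)‖ + ‖q‖ := by
      calc ‖s • (x - q)‖ = ‖(q + s • (x - q)) - q‖ := by simp
        _ ≤ _ := norm_sub_le _ _
    rw [norm_smul, Real.norm_eq_abs] at h3
    have h4 := mul_le_mul_of_nonneg_right (le_abs_self s) hpos.le
    simp only [φ] at h2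
    linarith
  refine ⟨sSup K, le_csSup hb h1, hKc.csSup_mem ⟨1, h1⟩ hb, fun hyint => ?_⟩
  have ho : IsOpen (φ ⁻¹' interior P) := isOpen_interior.preimage hφ
  obtain ⟨ε, hε, hball⟩ := Metric.isOpen_iff.1 ho (sSup K) hyint
  have hmem : sSup K + ε / 2 ∈ K := by
    have : sSup K + ε / 2 ∈ φ ⁻¹' interior P := hball (by
      rw [Metric.mem_ball, Real.dist_eq, add_sub_cancel_left, abs_of_pos (by linarith)]; linarith)
    exact (interior_subset (s := P) this : φ _ ∈ P)
  have := le_csSup hb hmem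
  linarith

theorem bh_cover (p : Fin 7 → bhE) (hgen : bhGen p) (q : bhE)
    (hq : q ∈ interior (convexHull ℝ (Set.range p))) (x : bhE) (hx : x ∈ convexHull ℝ (Set.range p))
    (hN : ∀ i j, x ∉ affineSpan ℝ ({q, p i, p j} : Set bhE)) :
    ∃ t ∈ bhO p, x ∈ convexHull ℝ ({q, p t.1, p t.2.1, p t.2.2} : Set bhE) := by
  classical
  set P := convexHull ℝ (Set.range p) with hPdef
  have hPc : IsCompact P := (Set.finite_range p).isCompact_convexHull (𝕜 := ℝ)
  have hconv : Convex ℝ P := convex_convexHull ℝ _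
  have hxq : x ≠ q := by
    rintro rfl
    exact hN 0 0 (subset_affineSpan ℝ _ (by simp))
  obtain ⟨s, hs1, hyP, hyi⟩ := bh_exit P hPc q x hx hxq
  set y := q + s • (x - q) with hy
  have hs0 : 0 < s := by linarith
  have hxy : x = AffineMap.lineMap q y s⁻¹ := by
    rw [AffineMap.lineMap_apply, hy]
    simp [smul_smul, inv_mul_cancel₀ hs0.ne']
  obtain ⟨f, hf⟩ := geometric_hahn_banach_open_point hconv.interior isOpen_interior hyi
  have hfq : f q < f y := hf q hq
  have hfP : ∀ a ∈ P, f a ≤ f y := by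
    intro a ha
    have hcl : a ∈ closure (interior P) := by
      rw [hconv.closure_interior_eq_closure_of_nonempty_interior ⟨q, hq⟩]
      exact subset_closure ha
    have : IsClosed {a | f a ≤ f y} := isClosed_le f.continuous continuous_const
    exact closure_minimal (fun b hb => (hf b hb).le) this hcl
  have hfp : ∀ i, f (p i) ≤ f y := fun i => hfP _ (subset_convexHull ℝ _ ⟨i, rfl⟩)
  set G : Finset (Fin 7) := Finset.univ.filter (fun i => f (p i) = f y) with hG
  have hyG : y ∈ convexHull ℝ (p '' (G : Set (Fin 7))) := by
    have hyP' := hyP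
    rw [hPdef, convexHull_range_eq_exists_affineCombination] at hyP'
    obtain ⟨S, w, hw0, hw1, hwy⟩ := hyP'
    rw [Finset.affineCombination_eq_linear_combination _ _ _ hw1] at hwy
    have hzero : ∑ i ∈ S, w i * (f y - f (p i)) = 0 := by
      have : f y = ∑ i ∈ S, w i * f (p i) := by
        conv_lhs => rw [← hwy]
        simp
      simp only [mul_sub, Finset.sum_sub_distrib, ← Finset.sum_mul, hw1]
      linarith
    have hz := (Finset.sum_eq_zero_iff_of_nonneg (fun i hi => mul_nonneg (hw0 i hi) (sub_nonneg.2 (hfp i)))).1 hzero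
    have hmem : ∀ i ∈ S, w i ≠ 0 → i ∈ G := by
      intro i hi hwi
      rcases mul_eq_zero.1 (hz i hi) with h | h
      · exact absurd h hwi
      · simp only [hG, Finset.mem_filter, Finset.mem_univ, true_and]; linarith
    have s1 : ∑ i ∈ S.filter (fun i => i ∈ G), w i = 1 := by
      rw [Finset.sum_filter_of_ne hmem, hw1]
    have s2 : ∑ i ∈ S.filter (fun i => i ∈ G), w i • p i = y := by
      rw [Finset.sum_filter_of_ne, hwy]
      intro i hi h
      exact hmem i hi (fun h0 => h (by rw [h0, zero_smul]))
    rw [← s2]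
    apply (convex_convexHull ℝ _).sum_mem
    · intro i hi; exact hw0 i (Finset.mem_filter.1 hi).1
    · exact s1
    · intro i hi
      exact subset_convexHull ℝ _ ⟨i, (Finset.mem_filter.1 hi).2, rfl⟩
  have hsmall : 2 < G.card := by
    by_contra hc
    have : ∃ i j, G ⊆ {i, j} := by
      have h3 : G.card = 0 ∨ G.card = 1 ∨ G.card = 2 := by omega
      rcases h3 with h | h | h
      · exact ⟨0, 0, by rw [Finset.card_eq_zero.1 h]; simp⟩
      · obtain ⟨a, ha⟩ := Finset.card_eq_one.1 h
        exact ⟨a, a, by rw [ha]; simp⟩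
      · obtain ⟨a, b, _, ha⟩ := Finset.card_eq_two.1 h
        exact ⟨a, b, by rw [ha]⟩
    obtain ⟨i, j, hij⟩ := this
    apply hN i j
    rw [hxy]
    apply AffineMap.lineMap_mem
    · exact subset_affineSpan ℝ _ (by simp)
    · have h1 : convexHull ℝ (p '' (G : Set (Fin 7))) ⊆ affineSpan ℝ ({q, p i, p j} : Set bhE) := by
        refine (convexHull_subset_affineSpan _).trans ?_
        apply affineSpan_mono
        rintro _ ⟨l, hl, rfl⟩
        have := hij (Finset.mem_coe.1 hl)
        simp only [Finset.mem_insert, Finset.mem_singleton] at this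
        rcases this with rfl | rfl <;> simp
      exact h1 hyG
  obtain ⟨i, hi, j, hj, k, hk, hij, hik, hjk⟩ := Finset.two_lt_card.1 hsmall
  have gi : f (p i) = f y := by simpa [hG] using hi
  have gj : f (p j) = f y := by simpa [hG] using hj
  have gk : f (p k) = f y := by simpa [hG] using hk
  have e1 : f (p j - p i) = 0 := by rw [map_sub, gi, gj, sub_self]
  have e2 : f (p k - p i) = 0 := by rw [map_sub, gi, gk, sub_self]
  have e3 : f (q - p i) < 0 := by rw [map_sub, gi]; linarith
  have hoth : ∀ l, l ≠ i → l ≠ j → l ≠ k → f (p l) < f y := by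
    intro l h1 h2 h3
    refine lt_of_le_of_ne (hfp l) (fun h => ?_)
    have := bh_ker f (p j - p i) (p k - p i) (p l - p i) (q - p i) e1 e2
    rw [show f (p l - p i) = 0 by rw [map_sub, gi, h, sub_self], mul_zero] at this
    have hB := hgen i j k l hij hik h1.symm hjk h2.symm h3.symm
    rw [bhB_first] at hB
    rcases mul_eq_zero.1 this with h | h
    · exact hB (by rw [h, neg_zero])
    · linarith
  have hGs : p '' (G : Set (Fin 7)) ⊆ {p i, p j, p k} := by
    rintro _ ⟨l, hl, rfl⟩
    have hl' : f (p l) = f y := by simpa [hG] using hl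
    by_cases h1 : l = i
    · simp [h1]
    by_cases h2 : l = j
    · simp [h2]
    by_cases h3 : l = k
    · simp [h3]
    exact absurd hl' (hoth l h1 h2 h3).ne
  have hyT : y ∈ convexHull ℝ ({p i, p j, p k} : Set bhE) := convexHull_mono hGs hyG
  have hxT : x ∈ convexHull ℝ ({q, p i, p j, p k} : Set bhE) := by
    rw [hxy]
    apply (convex_convexHull ℝ _).lineMap_mem
    · exact subset_convexHull ℝ _ (by simp)
    · exact convexHull_mono (by simp) hyT
    · exact ⟨by positivity, inv_le_one_of_one_le₀ hs1⟩
  -- orientation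
  have hor : ∀ l, l ≠ i → l ≠ j → l ≠ k →
      0 < bhB p i j k l * (- bhD (p j - p i) (p k - p i) (q - p i)) := by
    intro l h1 h2 h3
    have id := bh_ker f (p j - p i) (p k - p i) (p l - p i) (q - p i) e1 e2
    have e4 : f (p l - p i) < 0 := by rw [map_sub, gi]; linarith [hoth l h1 h2 h3]
    have hB := hgen i j k l hij hik h1.symm hjk h2.symm h3.symm
    rw [bhB_first] at hB ⊢
    set X := bhD (p j - p i) (p k - p i) (p l - p i)
    set Y := bhD (p j - p i) (p k - p i) (q - p i)
    have hX : X ≠ 0 := fun h => hB (by rw [h, neg_zero])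
    have hY : Y = X * (f (q - p i) / f (p l - p i)) := by
      rw [← mul_div_assoc, eq_div_iff e4.ne]
      linarith
    rw [hY]
    have : 0 < f (q - p i) / f (p l - p i) := div_pos_of_neg_of_neg e3 e4
    have h2 : 0 < X ^ 2 := by positivity
    nlinarith [mul_pos h2 this]
  by_cases hY : 0 < - bhD (p j - p i) (p k - p i) (q - p i)
  · refine ⟨(i, j, k), ?_, hxT⟩
    rw [bhO_mem]
    refine ⟨hij, hjk, hik, fun l h1 h2 h3 => ?_⟩
    exact (pos_iff_pos_of_mul_pos (hor l h1 h2 h3)).2 hY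
  · refine ⟨(j, i, k), ?_, ?_⟩
    · rw [bhO_mem]
      refine ⟨hij.symm, hik, hjk, fun l h1 h2 h3 => ?_⟩
      rw [bhB_swap12]
      have := hor l h2 h1 h3
      by_contra hc
      have h5 : 0 ≤ bhB p i j k l := by linarith
      have := mul_nonpos_of_nonneg_of_nonpos h5 (not_lt.1 hY)
      linarith
    · have : ({q, p j, p i, p k} : Set bhE) = {q, p i, p j, p k} := by
        rw [Set.insert_comm (p j)]
      simp only [this]
      exact hxT

/-- volume form from `q` -/
noncomputable def bhgq (p : Fin 7 → bhE) (q : bhE) (t : Fin 7 × Fin 7 × Fin 7) : ℝ :=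
  bhD (p t.1 - q) (p t.2.1 - q) (p t.2.2 - q)

theorem bhgq_nonneg (p : Fin 7 → bhE) (q : bhE) (hq : q ∈ convexHull ℝ (Set.range p))
    (t : Fin 7 × Fin 7 × Fin 7) (ht : t ∈ bhO p) : 0 ≤ bhgq p q t := by
  rw [bhO_mem] at ht
  have : convexHull ℝ (Set.range p) ⊆ {q | 0 ≤ bhgq p q t} := by
    apply convexHull_min
    · rintro _ ⟨l, rfl⟩
      change 0 ≤ bhgq p (p l) t
      by_cases h1 : l = t.1
      · apply le_of_eq; simp [bhgq, h1, bhD]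
      by_cases h2 : l = t.2.1
      · apply le_of_eq; simp [bhgq, h2, bhD]
      by_cases h3 : l = t.2.2
      · apply le_of_eq; simp [bhgq, h3, bhD]
      exact (ht.2.2.2 l h1 h2 h3).le
    · intro x hx y hy a b ha hb hab
      change 0 ≤ bhgq p (a • x + b • y) t
      have e : bhgq p (a • x + b • y) t = a * bhgq p x t + b * bhgq p y t := by
        obtain rfl : b = 1 - a := by linarith
        simp only [bhgq, bhD, PiLp.sub_apply, PiLp.add_apply, PiLp.smul_apply, smul_eq_mul]
        ring
      rw [e]
      exact add_nonneg (mul_nonneg ha hx) (mul_nonneg hb hy)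
  exact this hq

theorem bh_cancel (p : Fin 7 → bhE) (hgen : bhGen p) (q : bhE) :
    ∑ t ∈ bhO p, bhgq p q t = ∑ t ∈ bhO p, bhg p t := by
  classical
  set κ : Fin 7 × Fin 7 × Fin 7 → ℝ := fun t => bhD (p t.1) (p t.2.1) q with hκ
  have e : ∀ t, bhgq p q t = bhg p t - (κ t + κ (bhrot t) + κ (bhrot (bhrot t))) := by
    intro t
    simp only [hκ, bhgq, bhg, bhrot, bhD, PiLp.sub_apply]
    ring
  have h3 := bh_third (bhO p) (bhO_rot p) (fun _ => 1) κ (fun _ => rfl)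
  simp only [one_mul] at h3
  have hopp : ∀ t ∈ bhO p, ∃ l, bhR p t.2.1 t.1 l := fun t ht =>
    bhR_opp p hgen _ _ _ ((bhO_mem p t).1 ht)
  choose N hN using hopp
  have hinv : ∑ t ∈ bhO p, κ t = 0 := by
    refine Finset.sum_involution (fun t ht => (t.2.1, t.1, N t ht)) ?_ ?_ ?_ ?_
    · intro t ht
      simp only [hκ, bhD]; ring
    · intro t ht _ h
      have := congrArg Prod.fst h
      exact ((bhO_mem p t).1 ht).1 this.symm
    · intro t ht
      rw [bhO_mem]; exact hN t ht
    · intro t ht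
      have h1 := hN (t.2.1, t.1, N t ht) ((bhO_mem p _).2 (hN t ht))
      have := bhR_un p _ _ _ _ h1 ((bhO_mem p t).1 ht)
      ext <;> simp [this]
  simp only [e, Finset.sum_sub_distrib]
  rw [h3, hinv]; ring

theorem bh_vol (p : Fin 7 → bhE) (hp : ∀ i, ‖p i‖ ≤ 1) (hgen : bhGen p)
    (hz : Function.Injective (fun i => p i 2)) :
    (volume (convexHull ℝ (Set.range p))).toReal ≤ (5 / 3) * sin (2 * π / 5) := by
  classical
  have hbound := bh_sum_bound p hp hgen hz
  have hconv : Convex ℝ (convexHull ℝ (Set.range p)) := convex_convexHull ℝ _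
  have hspos := bh_sin_pos
  rcases (interior (convexHull ℝ (Set.range p))).eq_empty_or_nonempty with hemp | ⟨q, hq⟩
  · have : volume (convexHull ℝ (Set.range p)) = 0 := by
      refine measure_mono_null ?_ (hconv.addHaar_frontier volume)
      rw [frontier, hemp, Set.sdiff_empty]
      exact subset_closure
    rw [this]
    simp only [ENNReal.toReal_zero]
    positivity
  have hne : ∀ t ∈ bhO p, t.1 ≠ t.2.1 ∧ t.2.1 ≠ t.2.2 ∧ t.1 ≠ t.2.2 := by
    intro t ht
    rw [bhO_mem] at ht
    exact ⟨ht.1, ht.2.1, ht.2.2.1⟩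
  set M := (bhO p).filter (bhmid (fun i => p i 2)) with hM
  set K : Fin 7 × Fin 7 × Fin 7 → Set bhE := fun t => convexHull ℝ ({q, p t.1, p t.2.1, p t.2.2} : Set bhE) with hK
  have hKrot : ∀ t, K (bhrot t) = K t := by
    intro t
    simp only [hK, bhrot]
    congr 1
    ext x
    simp only [Set.mem_insert_iff, Set.mem_singleton_iff]
    tauto
  have hcov : volume (convexHull ℝ (Set.range p)) ≤ volume (⋃ t ∈ M, K t) := by
    apply measure_mono_ae
    have hnull : ∀ᵐ x : bhE, ∀ i j, x ∉ affineSpan ℝ ({q, p i, p j} : Set bhE) := by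
      rw [ae_all_iff]; intro i
      rw [ae_all_iff]; intro j
      exact measure_eq_zero_iff_ae_notMem.1 (bh_null q (p i) (p j))
    filter_upwards [hnull] with x hxN hx
    obtain ⟨t, ht, hxt⟩ := bh_cover p hgen q hq x hx hxN
    change x ∈ ⋃ t ∈ M, K t
    simp only [Set.mem_iUnion, exists_prop]
    obtain ⟨n1, n2, n3⟩ := hne t ht
    have hmid := bh_mid_sum (fun i => p i 2) hz t n1 n2 n3
    by_cases m1 : bhmid (fun i => p i 2) t
    · exact ⟨t, Finset.mem_filter.2 ⟨ht, m1⟩, hxt⟩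
    by_cases m2 : bhmid (fun i => p i 2) (bhrot t)
    · exact ⟨bhrot t, Finset.mem_filter.2 ⟨bhO_rot p _ ht, m2⟩, by rw [hKrot]; exact hxt⟩
    by_cases m3 : bhmid (fun i => p i 2) (bhrot (bhrot t))
    · exact ⟨bhrot (bhrot t), Finset.mem_filter.2 ⟨bhO_rot p _ (bhO_rot p _ ht), m3⟩, by
        rw [hKrot, hKrot]; exact hxt⟩
    simp [m1, m2, m3] at hmid
  have hle : volume (convexHull ℝ (Set.range p)) ≤ ENNReal.ofReal (∑ t ∈ M, bhgq p q t / 6) := by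
    refine hcov.trans ((measure_biUnion_finset_le _ _).trans ?_)
    rw [ENNReal.ofReal_sum_of_nonneg]
    · apply Finset.sum_le_sum
      intro t ht
      have h0 := bhgq_nonneg p q (interior_subset hq) t (Finset.mem_filter.1 ht).1
      have := bh_simplex q (p t.1) (p t.2.1) (p t.2.2)
      have h1 : |bhD (p t.1 - q) (p t.2.1 - q) (p t.2.2 - q)| = bhgq p q t := abs_of_nonneg h0
      rw [h1] at this
      exact this
    · intro t ht
      have h0 := bhgq_nonneg p q (interior_subset hq) t (Finset.mem_filter.1 ht).1
      positivity
  have h3 := bh_mid_third (bhO p) (bhO_rot p) (fun i => p i 2) hz hne (bhgq p q) (fun t => bhD_rot _ _ _)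
  rw [bh_cancel p hgen q] at h3
  refine ENNReal.toReal_le_of_le_ofReal (by positivity) (hle.trans (ENNReal.ofReal_le_ofReal ?_))
  rw [← Finset.sum_div]
  linarith

theorem bh_poly (c0 c1 c2 c3 : ℝ) (h : c1 ≠ 0 ∨ c3 ≠ 0) :
    {t : ℝ | c0 + c1 * t + c2 * t ^ 2 + c3 * t ^ 3 = 0}.Finite := by
  classical
  set Q : Polynomial ℝ := Polynomial.C c0 + Polynomial.C c1 * Polynomial.X +
    Polynomial.C c2 * Polynomial.X ^ 2 + Polynomial.C c3 * Polynomial.X ^ 3 with hQ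
  have hne : Q ≠ 0 := by
    intro h0
    rcases h with h | h
    · apply h
      have := congrArg (fun P => Polynomial.coeff P 1) h0
      simpa [hQ, Polynomial.coeff_X, Polynomial.coeff_C, Polynomial.coeff_X_pow] using this
    · apply h
      have := congrArg (fun P => Polynomial.coeff P 3) h0
      simpa [hQ, Polynomial.coeff_X, Polynomial.coeff_C, Polynomial.coeff_X_pow] using this
  refine (Q.roots.toFinset.finite_toSet).subset ?_
  intro t ht
  simp only [Finset.mem_coe, Multiset.mem_toFinset, Polynomial.mem_roots hne, Polynomial.IsRoot.def]
  simpa [hQ] using ht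

/-- the moment curve -/
noncomputable def bhm (i : Fin 7) : bhE := !₂[((i : ℕ) : ℝ), ((i : ℕ) : ℝ) ^ 2, ((i : ℕ) : ℝ) ^ 3]

theorem bhm_det (i j k l : Fin 7) (hij : i ≠ j) (hik : i ≠ k) (hil : i ≠ l) (hjk : j ≠ k) (hjl : j ≠ l)
    (hkl : k ≠ l) : bhD (bhm i - bhm l) (bhm j - bhm l) (bhm k - bhm l) ≠ 0 := by
  have cast : ∀ a b : Fin 7, a ≠ b → ((a : ℕ) : ℝ) - ((b : ℕ) : ℝ) ≠ 0 := by
    intro a b h h2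
    apply h
    have : ((a : ℕ) : ℝ) = ((b : ℕ) : ℝ) := by linarith
    exact Fin.ext (by exact_mod_cast this)
  have e : bhD (bhm i - bhm l) (bhm j - bhm l) (bhm k - bhm l) =
      (((i : ℕ) : ℝ) - ((l : ℕ) : ℝ)) * (((j : ℕ) : ℝ) - ((l : ℕ) : ℝ)) * (((k : ℕ) : ℝ) - ((l : ℕ) : ℝ)) *
      (((j : ℕ) : ℝ) - ((i : ℕ) : ℝ)) * (((k : ℕ) : ℝ) - ((i : ℕ) : ℝ)) * (((k : ℕ) : ℝ) - ((j : ℕ) : ℝ)) := by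
    simp [bhD, bhm]; ring
  rw [e]
  exact mul_ne_zero (mul_ne_zero (mul_ne_zero (mul_ne_zero (mul_ne_zero (cast _ _ hil) (cast _ _ hjl))
    (cast _ _ hkl)) (cast _ _ hij.symm)) (cast _ _ hik.symm)) (cast _ _ hjk.symm)

theorem bh_ev (S : Set ℝ) (hS : S.Finite) : ∀ᶠ t in nhdsWithin (0 : ℝ) (Set.Ioi 0), t ∉ S := by
  have h1 : nhdsWithin (0 : ℝ) (Set.Ioi 0) ≤ nhdsWithin 0 {0}ᶜ :=
    nhdsWithin_mono _ (fun x hx => ne_of_gt hx)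
  exact (h1.trans (nhdsNE_le_cofinite 0)) hS.compl_mem_cofinite

theorem bh_perturb (a : Fin 7 → bhE) (δ : ℝ) (hδ : 0 < δ) :
    ∃ t : ℝ, (∀ i, ‖t • bhm i‖ ≤ δ) ∧ bhGen (fun i => a i + t • bhm i) ∧
      Function.Injective (fun i => (a i + t • bhm i) 2) := by
  have e1 : ∀ᶠ t in nhdsWithin (0 : ℝ) (Set.Ioi 0), ∀ i, ‖t • bhm i‖ ≤ δ := by
    rw [Filter.eventually_all]
    intro i
    apply Filter.Eventually.filter_mono nhdsWithin_le_nhds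
    have hc : ContinuousAt (fun t : ℝ => ‖t • bhm i‖) 0 := by fun_prop
    have := hc.eventually_le_const (u := δ) (by simpa using hδ)
    exact this
  have e2 : ∀ᶠ t in nhdsWithin (0 : ℝ) (Set.Ioi 0), bhGen (fun i => a i + t • bhm i) := by
    unfold bhGen
    simp only [Filter.eventually_all]
    intro i j k l hij hik hil hjk hjl hkl
    have hd := bhm_det i j k l hij hik hil hjk hjl hkl
    set u := a i - a l
    set v := a j - a l
    set w := a k - a l
    set u' := bhm i - bhm l
    set v' := bhm j - bhm l
    set w' := bhm k - bhm l
    have hfin := bh_poly (bhD u v w) (bhD u' v w + bhD u v' w + bhD u v w')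
      (bhD u' v' w + bhD u' v w' + bhD u v' w') (bhD u' v' w') (Or.inr hd)
    filter_upwards [bh_ev _ hfin] with t ht h0
    apply ht
    change _ = _
    rw [← h0]
    have : ∀ x y : Fin 7, a x + t • bhm x - (a y + t • bhm y) = (a x - a y) + t • (bhm x - bhm y) := by
      intro x y; rw [smul_sub]; abel
    simp only [bhB, this]
    change _ = bhD (u + t • u') (v + t • v') (w + t • w')
    simp only [bhD, PiLp.add_apply, PiLp.smul_apply, smul_eq_mul]
    ring
  have e3 : ∀ᶠ t in nhdsWithin (0 : ℝ) (Set.Ioi 0), ∀ i j : Fin 7, i ≠ j →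
      (a i + t • bhm i) 2 ≠ (a j + t • bhm j) 2 := by
    simp only [Filter.eventually_all]
    intro i j hij
    have hc : bhm i 2 - bhm j 2 ≠ 0 := by
      intro h
      have h3 : ((i : ℕ) : ℝ) ^ 3 = ((j : ℕ) : ℝ) ^ 3 := by
        simp [bhm] at h; linarith
      have h4 := (pow_left_inj₀ (Nat.cast_nonneg _) (Nat.cast_nonneg _) (by norm_num)).1 h3
      exact hij (Fin.ext (by exact_mod_cast h4))
    have hfin := bh_poly (a i 2 - a j 2) (bhm i 2 - bhm j 2) 0 0 (Or.inl hc)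
    filter_upwards [bh_ev _ hfin] with t ht h0
    apply ht
    change _ = _
    simp only [PiLp.add_apply, PiLp.smul_apply, smul_eq_mul] at h0
    linarith
  obtain ⟨t, h1, h2, h3⟩ := (e1.and (e2.and e3)).exists
  exact ⟨t, h1, h2, fun i j h => by by_contra hij; exact h3 i j hij h⟩

theorem bh_shrink (p p' : Fin 7 → bhE) (q : bhE) (r ε : ℝ) (hε : 0 < ε) (hε1 : ε < 1)
    (hr : Metric.ball q r ⊆ convexHull ℝ (Set.range p)) (hd : ∀ i, ‖p i - p' i‖ < ε * r) :
    AffineMap.homothety q (1 - ε) '' (convexHull ℝ (Set.range p)) ⊆ convexHull ℝ (Set.range p') := by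
  rintro _ ⟨x, hx, rfl⟩
  by_contra hc
  have hcl : IsClosed (convexHull ℝ (Set.range p')) :=
    ((Set.finite_range p').isCompact_convexHull (𝕜 := ℝ)).isClosed
  obtain ⟨f, u, hf, hu⟩ := geometric_hahn_banach_closed_point (convex_convexHull ℝ _) hcl hc
  obtain ⟨m, _, hm⟩ := Finset.exists_max_image Finset.univ (fun i => f (p i)) ⟨0, Finset.mem_univ _⟩
  have hP : ∀ z ∈ convexHull ℝ (Set.range p), f z ≤ f (p m) := by
    intro z hz
    have : convexHull ℝ (Set.range p) ⊆ {z | f z ≤ f (p m)} := by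
      apply convexHull_min
      · rintro _ ⟨i, rfl⟩; exact hm i (Finset.mem_univ _)
      · exact convex_halfSpace_le f.toLinearMap.isLinear _
    exact this hz
  have h1 : f (q + ε⁻¹ • (p m - p' m)) ≤ f (p m) := by
    apply hP
    apply hr
    rw [Metric.mem_ball, dist_eq_norm, add_sub_cancel_left, norm_smul, norm_inv, Real.norm_eq_abs,
      abs_of_pos hε, inv_mul_lt_iff₀ hε]
    exact hd m
  have h2 := hf (p' m) (subset_convexHull ℝ _ ⟨m, rfl⟩)
  have h3 := hP x hx
  rw [AffineMap.homothety_apply] at hu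
  simp only [vsub_eq_sub, vadd_eq_add, map_add, map_smul, map_sub, smul_eq_mul] at hu h1
  have h4 : f (p m) - f (p' m) ≤ ε * (f (p m) - f q) := by
    have : ε⁻¹ * (f (p m) - f (p' m)) ≤ f (p m) - f q := by linarith
    rwa [inv_mul_le_iff₀ hε] at this
  nlinarith

theorem bh_main (p : Fin 7 → bhE) (hp : ∀ i, ‖p i‖ = 1) :
    (volume (convexHull ℝ (Set.range p))).toReal ≤ (5 / 3) * sin (2 * π / 5) := by
  have hconv : Convex ℝ (convexHull ℝ (Set.range p)) := convex_convexHull ℝ _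
  have hspos := bh_sin_pos
  rcases (interior (convexHull ℝ (Set.range p))).eq_empty_or_nonempty with hemp | ⟨q, hq⟩
  · have : volume (convexHull ℝ (Set.range p)) = 0 := by
      refine measure_mono_null ?_ (hconv.addHaar_frontier volume)
      rw [frontier, hemp, Set.sdiff_empty]
      exact subset_closure
    rw [this]
    simp only [ENNReal.toReal_zero]
    positivity
  obtain ⟨r, hr0, hr⟩ := Metric.mem_nhds_iff.1 (mem_interior_iff_mem_nhds.1 hq)
  set V := (volume (convexHull ℝ (Set.range p))).toReal with hV
  have key : ∀ ε : ℝ, 0 < ε → ε < 1 → (1 - ε) ^ 3 * V ≤ (5 / 3) * sin (2 * π / 5) := by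
    intro ε h0 h1
    set δ := min 1 (ε * r / 3) with hδ
    have hδ0 : 0 < δ := by positivity
    have hδ1 : δ ≤ 1 := min_le_left _ _
    have hδ2 : δ ≤ ε * r / 3 := min_le_right _ _
    obtain ⟨t, ht, hgen, hz⟩ := bh_perturb (fun i => (1 - δ) • p i) δ hδ0
    set p' : Fin 7 → bhE := fun i => (1 - δ) • p i + t • bhm i with hp'
    have hn : ∀ i, ‖p' i‖ ≤ 1 := by
      intro i
      calc ‖p' i‖ ≤ ‖(1 - δ) • p i‖ + ‖t • bhm i‖ := norm_add_le _ _
        _ ≤ (1 - δ) + δ := by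
            rw [norm_smul, hp i, Real.norm_eq_abs, abs_of_nonneg (by linarith), mul_one]
            linarith [ht i]
        _ = 1 := by ring
    have hd : ∀ i, ‖p i - p' i‖ < ε * r := by
      intro i
      have e : p i - p' i = δ • p i - t • bhm i := by
        simp only [hp', sub_smul, one_smul]; abel
      rw [e]
      calc _ ≤ ‖δ • p i‖ + ‖t • bhm i‖ := norm_sub_le _ _
        _ ≤ δ + δ := by
            rw [norm_smul, hp i, Real.norm_eq_abs, abs_of_pos hδ0, mul_one]
            linarith [ht i]
        _ < ε * r := by nlinarith [mul_pos h0 hr0]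
    have hv := bh_vol p' hn hgen hz
    have hs := measure_mono (μ := volume) (bh_shrink p p' q r ε h0 h1 hr hd)
    rw [Measure.addHaar_image_homothety] at hs
    have hfin : volume (convexHull ℝ (Set.range p')) ≠ ⊤ :=
      ((Set.finite_range p').isCompact_convexHull (𝕜 := ℝ)).measure_lt_top.ne
    have hs' := ENNReal.toReal_mono hfin hs
    rw [ENNReal.toReal_mul, ENNReal.toReal_ofReal (abs_nonneg _), finrank_euclideanSpace, Fintype.card_fin,
      abs_of_pos (by have : 0 < 1 - ε := by linarith
                     positivity)] at hs'
    linarith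
  have hlim : Filter.Tendsto (fun ε : ℝ => (1 - ε) ^ 3 * V) (nhdsWithin 0 (Set.Ioi 0)) (nhds V) := by
    have hc : Continuous (fun ε : ℝ => (1 - ε) ^ 3 * V) := by fun_prop
    have := hc.tendsto 0
    simp only [sub_zero, one_pow, one_mul] at this
    exact this.mono_left nhdsWithin_le_nhds
  refine le_of_tendsto hlim ?_
  filter_upwards [Ioo_mem_nhdsGT (zero_lt_one' ℝ)] with ε hε
  exact key ε hε.1 hε.2

/-- Berman–Hanes: the maximal volume polyhedron with 7 vertices inscribed in the unit
sphere of Euclidean 3-space is the pentagonal bipyramid, of volume `(5/3)·sin(2π/5)`. -/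
theorem berman_hanes_seven_vertices (p : Fin 7 → EuclideanSpace ℝ (Fin 3))
    (hp : ∀ i, ‖p i‖ = 1) :
    (volume (convexHull ℝ (Set.range p))).toReal ≤ (5 / 3) * Real.sin (2 * π / 5) :=
  bh_main p hp
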